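/- arXiv:math/0503344 — 2 statements merged into one kernel-verified Lean document; each statement's English description precedes it below -/
import Mathlib

section
/- Let (V,1) be a matrix order unit space and K = (K_n) a compact matrix convex subset of CS(V). View the elements of V as matrix affine maps from CS(V) to ℂ, let W consist of their restrictions to K, and let φ : V → W be the restriction map. Then (W, φ(1)) is a matrix order unit space, and K = φ^c(CS(W)), i.e. K_n = φ^c_n(CS_n(W)) for every n. -/
open scoped ComplexOrder

noncomputable section

/-- The operator (ℓ² → ℓ²) norm of a complex scalar matrix. -/
noncomputable def scalarOpNorm {m n : Type*} [Fintype m] [Fintype n] [DecidableEq n]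
    (γ : Matrix m n ℂ) : ℝ :=
  ‖LinearMap.toContinuousLinearMap (Matrix.toEuclideanLin γ)‖

/-- A matrix order unit space `(V, 1)`: a complex *-vector space with a distinguished
matrix ordering (given by the graded family of positive cones) and an Archimedean
matrix order unit. -/
structure MOUS : Type 1 where
  carrier : Type
  [acg : AddCommGroup carrier]
  [mod : Module ℂ carrier]
  [sam : StarAddMonoid carrier]
  [sm : StarModule ℂ carrier]
  one : carrier
  pos : ∀ n : ℕ, Set (Matrix (Fin n) (Fin n) carrier)
  pos_add : ∀ n, ∀ v ∈ pos n, ∀ w ∈ pos n, v + w ∈ pos n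
  pos_smul : ∀ n (t : ℝ), 0 ≤ t → ∀ v ∈ pos n, (t : ℂ) • v ∈ pos n
  pos_star : ∀ n, ∀ v ∈ pos n, v.conjTranspose = v
  pos_congr : ∀ n m (γ : Matrix (Fin n) (Fin m) ℂ), ∀ v ∈ pos n,
    (Matrix.of fun i j => ∑ k, ∑ l, (star (γ k i) * γ l j) • v k l) ∈ pos m
  proper : ∀ v : Matrix (Fin 1) (Fin 1) carrier, v ∈ pos 1 → -v ∈ pos 1 → v = 0
  unit_pos : ∀ n, Matrix.diagonal (fun _ => one) ∈ pos n
  orderUnit : ∀ v : carrier, star v = v →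
    ∃ t : ℝ, 0 < t ∧
      (Matrix.of fun _ _ => (t : ℂ) • one - v : Matrix (Fin 1) (Fin 1) carrier) ∈ pos 1
  archimedean : ∀ n (v : Matrix (Fin n) (Fin n) carrier),
    (∀ t : ℝ, 0 < t → v + (t : ℂ) • Matrix.diagonal (fun _ => one) ∈ pos n) → v ∈ pos n

attribute [instance] MOUS.acg MOUS.mod MOUS.sam MOUS.sm

/-- Entrywise application of a linear map to a matrix. -/
def mapMat {V W : Type} [AddCommGroup V] [AddCommGroup W] [Module ℂ V] [Module ℂ W]
    (φ : V →ₗ[ℂ] W) {n : ℕ} (a : Matrix (Fin n) (Fin n) V) : Matrix (Fin n) (Fin n) W :=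
  Matrix.of fun i j => φ (a i j)

/-- The direct sum (block diagonal) of two matrices over a vector space. -/
def dsumMat {V : Type} [AddCommGroup V] {m n : ℕ}
    (v : Matrix (Fin m) (Fin m) V) (w : Matrix (Fin n) (Fin n) V) :
    Matrix (Fin (m + n)) (Fin (m + n)) V :=
  Matrix.reindex finSumFinEquiv finSumFinEquiv (Matrix.fromBlocks v 0 0 w)

/-- The two-sided scalar matrix product `α v β`. -/
def mmulMat {V : Type} [AddCommGroup V] [Module ℂ V] {m n : ℕ}
    (α : Matrix (Fin n) (Fin m) ℂ) (v : Matrix (Fin m) (Fin m) V)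
    (β : Matrix (Fin m) (Fin n) ℂ) : Matrix (Fin n) (Fin n) V :=
  Matrix.of fun i j => ∑ k, ∑ l, (α i k * β l j) • v k l

/-- The unit matrix `1ₙ` in `Mₙ(V)`. -/
def MOUS.unitMat (A : MOUS) (n : ℕ) : Matrix (Fin n) (Fin n) A.carrier :=
  Matrix.diagonal fun _ => A.one

/-- The matrix norm determined by the matrix order:
`‖v‖ = inf { t : [[t1, v], [v*, t1]] ≥ 0 }`. -/
def MOUS.matNorm (A : MOUS) {n : ℕ} (v : Matrix (Fin n) (Fin n) A.carrier) : ℝ :=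
  sInf {t : ℝ | (Matrix.reindex finSumFinEquiv finSumFinEquiv
    (Matrix.fromBlocks ((t : ℂ) • A.unitMat n) v v.conjTranspose ((t : ℂ) • A.unitMat n)))
      ∈ A.pos (n + n)}

/-- A matrix Lipschitz seminorm on a matrix order unit space. -/
structure IsMatrixLipschitzSeminorm (A : MOUS)
    (L : ∀ n : ℕ, Matrix (Fin n) (Fin n) A.carrier → ℝ) : Prop where
  nonneg : ∀ n v, 0 ≤ L n v
  add_le : ∀ n v w, L n (v + w) ≤ L n v + L n w
  smul_eq : ∀ n (c : ℂ) v, L n (c • v) = ‖c‖ * L n v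
  null_iff : ∀ n v, L n v = 0 ↔
    ∃ lam : Matrix (Fin n) (Fin n) ℂ, v = Matrix.of fun i j => lam i j • A.one
  dsum_eq : ∀ m n v w, L (m + n) (dsumMat v w) = max (L m v) (L n w)
  mmul_le : ∀ m n (α : Matrix (Fin n) (Fin m) ℂ) v (β : Matrix (Fin m) (Fin n) ℂ),
    L n (mmulMat α v β) ≤ scalarOpNorm α * L m v * scalarOpNorm β
  star_eq : ∀ n v, L n (Matrix.conjTranspose v) = L n v

/-- A matrix seminorm (finite matrix gauge). -/
structure IsMatrixSeminorm (A : MOUS)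
    (N : ∀ n : ℕ, Matrix (Fin n) (Fin n) A.carrier → ℝ) : Prop where
  nonneg : ∀ n v, 0 ≤ N n v
  add_le : ∀ n v w, N n (v + w) ≤ N n v + N n w
  smul_le : ∀ n (c : ℂ) v, N n (c • v) ≤ ‖c‖ * N n v
  dsum_eq : ∀ m n v w, N (m + n) (dsumMat v w) = max (N m v) (N n w)
  mmul_le : ∀ m n (α : Matrix (Fin n) (Fin m) ℂ) v (β : Matrix (Fin m) (Fin n) ℂ),
    N n (mmulMat α v β) ≤ scalarOpNorm α * N m v * scalarOpNorm β

/-- Linear maps from `V` to `Mₙ(ℂ)`; matrix states live here. -/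
abbrev MState (A : MOUS) (n : ℕ) := A.carrier →ₗ[ℂ] Matrix (Fin n) (Fin n) ℂ

/-- The matrix pairing `⟨⟨φ, a⟩⟩ = [φ(a_{ij})] ∈ M_{rn}(ℂ)`. -/
def mpair {A : MOUS} {n r : ℕ} (φ : MState A n) (a : Matrix (Fin r) (Fin r) A.carrier) :
    Matrix (Fin r × Fin n) (Fin r × Fin n) ℂ :=
  Matrix.of fun p q => φ (a p.1 q.1) p.2 q.2

/-- The `n`-th matrix state space: unital completely positive maps `V → Mₙ(ℂ)`. -/
def CS (A : MOUS) (n : ℕ) : Set (MState A n) :=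
  {φ | φ A.one = 1 ∧ ∀ r, ∀ v ∈ A.pos r, (mpair φ v).PosSemidef}

/-- The matrix metric `D_{Lₙ}` on matrix states coming from a matrix Lipschitz seminorm. -/
def Dmet (A : MOUS) (L : ∀ n : ℕ, Matrix (Fin n) (Fin n) A.carrier → ℝ) (n : ℕ)
    (φ ψ : MState A n) : ℝ :=
  sSup {x | ∃ (r : ℕ) (a : Matrix (Fin r) (Fin r) A.carrier), L r a ≤ 1 ∧
    x = scalarOpNorm (mpair φ a - mpair ψ a)}

/-- The BW (pointwise, weak-*) topology on the space of linear maps `V → Mₙ(ℂ)`. -/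
def lmTop (A : MOUS) (n : ℕ) : TopologicalSpace (MState A n) :=
  TopologicalSpace.induced (fun φ => (φ : A.carrier → Matrix (Fin n) (Fin n) ℂ)) inferInstance

/-- The BW topology on the matrix state space. -/
def BWtop (A : MOUS) (n : ℕ) : TopologicalSpace {φ : MState A n // φ ∈ CS A n} :=
  TopologicalSpace.induced Subtype.val (lmTop A n)

/-- The topology on the matrix state space defined by the matrix metric `D_L`. -/
def Dtop (A : MOUS) (L : ∀ n : ℕ, Matrix (Fin n) (Fin n) A.carrier → ℝ) (n : ℕ) :
    TopologicalSpace {φ : MState A n // φ ∈ CS A n} :=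
  TopologicalSpace.generateFrom
    {U | ∃ (φ₀ : {φ : MState A n // φ ∈ CS A n}) (ε : ℝ), 0 < ε ∧
      U = {ψ | Dmet A L n φ₀.1 ψ.1 < ε}}

/-- A matrix Lip-norm: a matrix Lipschitz seminorm for which the `D_L`-topology on
each matrix state space agrees with the BW-topology. -/
structure IsMatrixLipNorm (A : MOUS)
    (L : ∀ n : ℕ, Matrix (Fin n) (Fin n) A.carrier → ℝ)
    extends IsMatrixLipschitzSeminorm A L : Prop where
  top_eq : ∀ n, Dtop A L n = BWtop A n

/-- A unital completely positive linear map between matrix order unit spaces. -/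
structure IsUCP (A B : MOUS) (φ : A.carrier →ₗ[ℂ] B.carrier) : Prop where
  unital : φ A.one = B.one
  cp : ∀ n, ∀ v ∈ A.pos n, mapMat φ v ∈ B.pos n

/-- `L` induces `LB` via the (surjective, UCP) map `φ`:
`LB` is the corresponding family of quotient seminorms. -/
def Induces (A B : MOUS) (φ : A.carrier →ₗ[ℂ] B.carrier)
    (L : ∀ n : ℕ, Matrix (Fin n) (Fin n) A.carrier → ℝ)
    (LB : ∀ n : ℕ, Matrix (Fin n) (Fin n) B.carrier → ℝ) : Prop :=
  ∀ n (b : Matrix (Fin n) (Fin n) B.carrier),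
    LB n b = sInf {x | ∃ a, mapMat φ a = b ∧ x = L n a}

/-- The quotient seminorm of `L` via `φ`. -/
def quotSeminorm (A B : MOUS) (φ : A.carrier →ₗ[ℂ] B.carrier)
    (L : ∀ n : ℕ, Matrix (Fin n) (Fin n) A.carrier → ℝ) (n : ℕ)
    (b : Matrix (Fin n) (Fin n) B.carrier) : ℝ :=
  sInf {x | ∃ a, mapMat φ a = b ∧ x = L n a}

/-- The operator space (matrix order unit space) direct sum `V₁ ⊕ V₂`. -/
def MOUS.prod (A B : MOUS) : MOUS where
  carrier := A.carrier × B.carrier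
  one := (A.one, B.one)
  pos n := {v | (Matrix.of fun i j => (v i j).1) ∈ A.pos n ∧
    (Matrix.of fun i j => (v i j).2) ∈ B.pos n}
  pos_add := by
    rintro n v ⟨hv1, hv2⟩ w ⟨hw1, hw2⟩
    exact ⟨A.pos_add n _ hv1 _ hw1, B.pos_add n _ hv2 _ hw2⟩
  pos_smul := by
    rintro n t ht v ⟨hv1, hv2⟩
    exact ⟨A.pos_smul n t ht _ hv1, B.pos_smul n t ht _ hv2⟩
  pos_star := by
    rintro n v ⟨hv1, hv2⟩
    have h1 := A.pos_star n _ hv1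
    have h2 := B.pos_star n _ hv2
    funext i j
    exact Prod.ext (congrFun (congrFun h1 i) j) (congrFun (congrFun h2 i) j)
  pos_congr := by
    rintro n m γ v ⟨hv1, hv2⟩
    constructor
    · have h1 := A.pos_congr n m γ _ hv1
      convert h1 using 2
      funext i j
      simp [Prod.fst_sum]
    · have h2 := B.pos_congr n m γ _ hv2
      convert h2 using 2
      funext i j
      simp [Prod.snd_sum]
  proper := by
    rintro v ⟨h1, h2⟩ ⟨h3, h4⟩
    have e1 := A.proper _ h1 h3
    have e2 := B.proper _ h2 h4
    funext i j
    exact Prod.ext (congrFun (congrFun e1 i) j) (congrFun (congrFun e2 i) j)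
  unit_pos := by
    intro n
    constructor
    · convert A.unit_pos n using 2
      funext i j
      by_cases hij : i = j <;> simp [Matrix.diagonal_apply, hij]
    · convert B.unit_pos n using 2
      funext i j
      by_cases hij : i = j <;> simp [Matrix.diagonal_apply, hij]
  orderUnit := by
    rintro ⟨a, b⟩ hstar
    have ha : star a = a := congrArg Prod.fst hstar
    have hb : star b = b := congrArg Prod.snd hstar
    obtain ⟨t₁, ht₁, hp₁⟩ := A.orderUnit a ha
    obtain ⟨t₂, ht₂, hp₂⟩ := B.orderUnit b hb
    have huA : (Matrix.of fun _ _ => A.one : Matrix (Fin 1) (Fin 1) A.carrier) ∈ A.pos 1 := by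
      convert A.unit_pos 1 using 2
      funext i j
      simp [Matrix.diagonal_apply, Subsingleton.elim i j]
    have huB : (Matrix.of fun _ _ => B.one : Matrix (Fin 1) (Fin 1) B.carrier) ∈ B.pos 1 := by
      convert B.unit_pos 1 using 2
      funext i j
      simp [Matrix.diagonal_apply, Subsingleton.elim i j]
    refine ⟨t₁ + t₂, add_pos ht₁ ht₂, ?_, ?_⟩
    · have e : (Matrix.of fun _ _ => ((t₁ + t₂ : ℝ) : ℂ) • A.one - a :
          Matrix (Fin 1) (Fin 1) A.carrier)
          = (Matrix.of fun _ _ => (t₁ : ℂ) • A.one - a) +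
            (t₂ : ℂ) • (Matrix.of fun _ _ => A.one) := by
        funext i j
        show ((t₁ + t₂ : ℝ) : ℂ) • A.one - a
          = ((t₁ : ℂ) • A.one - a) + (t₂ : ℂ) • A.one
        push_cast
        rw [add_smul]
        abel
      exact e ▸ A.pos_add 1 _ hp₁ _ (A.pos_smul 1 t₂ ht₂.le _ huA)
    · have e : (Matrix.of fun _ _ => ((t₁ + t₂ : ℝ) : ℂ) • B.one - b :
          Matrix (Fin 1) (Fin 1) B.carrier)
          = (Matrix.of fun _ _ => (t₂ : ℂ) • B.one - b) +
            (t₁ : ℂ) • (Matrix.of fun _ _ => B.one) := by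
        funext i j
        show ((t₁ + t₂ : ℝ) : ℂ) • B.one - b
          = ((t₂ : ℂ) • B.one - b) + (t₁ : ℂ) • B.one
        push_cast
        rw [add_smul]
        abel
      exact e ▸ B.pos_add 1 _ hp₂ _ (B.pos_smul 1 t₁ ht₁.le _ huB)
  archimedean := by
    rintro n v h
    constructor
    · apply A.archimedean
      intro t ht
      have h1 := (h t ht).1
      have e : (Matrix.of fun i j =>
            (((v + (t : ℂ) • Matrix.diagonal fun _ =>
              ((A.one, B.one) : A.carrier × B.carrier) :
                Matrix (Fin n) (Fin n) (A.carrier × B.carrier))) i j).1)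
          = (Matrix.of fun i j => (v i j).1) +
            (t : ℂ) • Matrix.diagonal fun _ => A.one := by
        funext i j
        by_cases hij : i = j <;>
          simp [Matrix.add_apply, Matrix.smul_apply, Matrix.diagonal_apply, hij]
      rw [e] at h1
      exact h1
    · apply B.archimedean
      intro t ht
      have h2 := (h t ht).2
      have e : (Matrix.of fun i j =>
            (((v + (t : ℂ) • Matrix.diagonal fun _ =>
              ((A.one, B.one) : A.carrier × B.carrier) :
                Matrix (Fin n) (Fin n) (A.carrier × B.carrier))) i j).2)
          = (Matrix.of fun i j => (v i j).2) +
            (t : ℂ) • Matrix.diagonal fun _ => B.one := by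
        funext i j
        by_cases hij : i = j <;>
          simp [Matrix.add_apply, Matrix.smul_apply, Matrix.diagonal_apply, hij]
      rw [e] at h2
      exact h2

/-- First coordinate projection `V₁ ⊕ V₂ → V₁`. -/
def fstL (A B : MOUS) : (A.prod B).carrier →ₗ[ℂ] A.carrier :=
  LinearMap.fst ℂ A.carrier B.carrier

/-- Second coordinate projection `V₁ ⊕ V₂ → V₂`. -/
def sndL (A B : MOUS) : (A.prod B).carrier →ₗ[ℂ] B.carrier :=
  LinearMap.snd ℂ A.carrier B.carrier

/-- `M(L₁, L₂)`: the set of matrix Lip-norms on `V₁ ⊕ V₂` inducing `L₁` and `L₂`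
via the coordinate projections. -/
def MSet (A : MOUS) (LA : ∀ n : ℕ, Matrix (Fin n) (Fin n) A.carrier → ℝ)
    (B : MOUS) (LB : ∀ n : ℕ, Matrix (Fin n) (Fin n) B.carrier → ℝ) :
    Set (∀ n : ℕ, Matrix (Fin n) (Fin n) (A.prod B).carrier → ℝ) :=
  {L | IsMatrixLipNorm (A.prod B) L ∧ Induces (A.prod B) A (fstL A B) L LA ∧
    Induces (A.prod B) B (sndL A B) L LB}

/-- Hausdorff distance between two sets with respect to a distance function. -/
def hDist {X : Type} (d : X → X → ℝ) (s t : Set X) : ℝ :=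
  max (sSup ((fun x => sInf ((fun y => d x y) '' t)) '' s))
      (sSup ((fun y => sInf ((fun x => d x y) '' s)) '' t))

/-- The quantized Gromov–Hausdorff distance between two quantized metric spaces. -/
def distNC (A : MOUS) (LA : ∀ n : ℕ, Matrix (Fin n) (Fin n) A.carrier → ℝ)
    (B : MOUS) (LB : ∀ n : ℕ, Matrix (Fin n) (Fin n) B.carrier → ℝ) : ℝ :=
  sInf {x | ∃ L ∈ MSet A LA B LB, x = ⨆ n : ℕ, ((n : ℝ) ^ 2)⁻¹ *
    hDist (Dmet (A.prod B) L n)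
      ((fun φ : MState A n => φ.comp (fstL A B)) '' CS A n)
      ((fun φ : MState B n => φ.comp (sndL A B)) '' CS B n)}

/-- The diameter of a quantized metric space: the diameter of `CS₁(V)` for `D_{L₁}`. -/
def qDiam (A : MOUS) (LA : ∀ n : ℕ, Matrix (Fin n) (Fin n) A.carrier → ℝ) : ℝ :=
  sSup {x | ∃ φ ∈ CS A 1, ∃ ψ ∈ CS A 1, x = Dmet A LA 1 φ ψ}

/-- Lower semicontinuity of a family of matrix seminorms for the order-unit matrix norms. -/
def IsLSCsem (A : MOUS) (L : ∀ n : ℕ, Matrix (Fin n) (Fin n) A.carrier → ℝ) : Prop :=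
  ∀ n (a : Matrix (Fin n) (Fin n) A.carrier) (c : ℝ), c < L n a →
    ∃ δ : ℝ, 0 < δ ∧ ∀ b, A.matNorm (b - a) < δ → c < L n b

/-- The matrix convex combination `Σᵢ γᵢ* φᵢ γᵢ` of matrix states. -/
def matComb {A : MOUS} {n k : ℕ} {ns : Fin k → ℕ}
    (φ : ∀ i, MState A (ns i)) (γ : ∀ i, Matrix (Fin (ns i)) (Fin n) ℂ) :
    MState A n where
  toFun a := ∑ i, (γ i).conjTranspose * φ i a * γ i
  map_add' := by
    intro a b
    simp only [map_add, Matrix.mul_add, Matrix.add_mul]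
    exact Finset.sum_add_distrib
  map_smul' := by
    intro c a
    simp only [map_smul, Matrix.mul_smul, Matrix.smul_mul, RingHom.id_apply]
    exact (Finset.smul_sum).symm

/-- A (graded) matrix convex subset of the matrix state space `CS(V)`. -/
def IsMatrixConvexSubset (A : MOUS) (K : ∀ n : ℕ, Set (MState A n)) : Prop :=
  (∀ n, K n ⊆ CS A n) ∧
  ∀ (n k : ℕ) (ns : Fin k → ℕ) (φ : ∀ i, MState A (ns i))
    (γ : ∀ i, Matrix (Fin (ns i)) (Fin n) ℂ),
    (∀ i, φ i ∈ K (ns i)) → (∑ i, (γ i).conjTranspose * γ i) = (1 : Matrix (Fin n) (Fin n) ℂ) →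
    matComb φ γ ∈ K n

/-- `(W, φ)` is the quotient of the matrix order unit space `V` with respect to the
(compact matrix convex) subset `K` of `CS(V)`: `W` consists of the restrictions to `K`
of the elements of `V` viewed as matrix affine mappings on `CS(V)`, `φ` being the
restriction mapping.  This is expressed by saying that `φ` is a surjective unital
completely positive map whose kernel and positivity are detected exactly by pairing
against the elements of `K`, and that `K = φᶜ(CS(W))`. -/
structure IsQuotientBy (A : MOUS) (K : ∀ n : ℕ, Set (MState A n)) (W : MOUS)
    (φ : A.carrier →ₗ[ℂ] W.carrier) : Prop where
  ucp : IsUCP A W φ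
  surj : Function.Surjective φ
  ker : ∀ (n : ℕ) (a : Matrix (Fin n) (Fin n) A.carrier),
    mapMat φ a = 0 ↔ ∀ r : ℕ, ∀ ψ ∈ K r, mpair ψ a = 0
  posChar : ∀ (n : ℕ) (a : Matrix (Fin n) (Fin n) A.carrier),
    mapMat φ a ∈ W.pos n ↔ ∀ r : ℕ, ∀ ψ ∈ K r, (mpair ψ a).PosSemidef
  image : ∀ n, K n = (fun ψ : MState W n => ψ.comp φ) '' CS W n

open scoped Matrix

section InverseSquareRoot

open scoped MatrixOrder Matrix.Norms.L2Operator

variable {n : Type*} [Fintype n] [DecidableEq n]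

/-- The inverse square root of a matrix. -/
def invSqrt (h : Matrix n n ℂ) : Matrix n n ℂ := (CFC.sqrt h)⁻¹

lemma invSqrt_conj {h : Matrix n n ℂ} (hh : h.PosSemidef) (hdet : IsUnit h.det) :
    (invSqrt h)ᴴ * h * invSqrt h = 1 := by
  have hnn : 0 ≤ h := Matrix.nonneg_iff_posSemidef.2 hh
  have hs : CFC.sqrt h * CFC.sqrt h = h := CFC.sqrt_mul_sqrt_self h
  have hsd : IsUnit (CFC.sqrt h).det := by
    rw [← hs, Matrix.det_mul] at hdet
    exact isUnit_of_mul_isUnit_left hdet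
  have hsa : (CFC.sqrt h)ᴴ = CFC.sqrt h :=
    (Matrix.nonneg_iff_posSemidef.1 (CFC.sqrt_nonneg h)).1
  unfold invSqrt
  rw [Matrix.conjTranspose_nonsing_inv, hsa]
  conv_lhs => enter [1, 2]; rw [← hs]
  rw [← mul_assoc, Matrix.nonsing_inv_mul _ hsd, one_mul, Matrix.mul_nonsing_inv _ hsd]

lemma tendsto_invSqrt_one :
    Filter.Tendsto (invSqrt : Matrix n n ℂ → Matrix n n ℂ)
      (nhdsWithin 1 {h | h.PosSemidef}) (nhds 1) := by
  have h1 : ContinuousWithinAt (CFC.sqrt : Matrix n n ℂ → Matrix n n ℂ)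
      {h | h.PosSemidef} 1 := by
    have := (CFC.continuousOn_sqrt (A := Matrix n n ℂ)) 1 (zero_le_one (α := Matrix n n ℂ))
    simpa only [Matrix.nonneg_iff_posSemidef] using this
  have h2 : ContinuousAt (fun x : Matrix n n ℂ => x⁻¹) (CFC.sqrt (1 : Matrix n n ℂ)) := by
    rw [CFC.sqrt_one]
    have : ContinuousAt Ring.inverse (1 : Matrix n n ℂ) :=
      NormedRing.inverse_continuousAt 1
    exact this.congr (Filter.Eventually.of_forall fun x =>
      (Matrix.nonsing_inv_eq_ringInverse x).symm)
  have h3 := h2.comp_continuousWithinAt h1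
  have h4 : (invSqrt (1 : Matrix n n ℂ)) = 1 := by simp [invSqrt]
  have h5 : ContinuousWithinAt (invSqrt : Matrix n n ℂ → Matrix n n ℂ) {h | h.PosSemidef} 1 := h3
  simpa only [ContinuousWithinAt, h4] using h5

end InverseSquareRoot

/-- A continuous functional on a product depends on finitely many coordinates only. -/
lemma exists_finset_eq_sum_single {ι E : Type*} [DecidableEq ι] [AddCommGroup E] [Module ℂ E]
    [TopologicalSpace E] (f : StrongDual ℂ (ι → E)) :
    ∃ F : Finset ι, ∀ x, f x = ∑ i ∈ F, f (Pi.single i (x i)) := by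
  have h0 : {x | ‖f x‖ < 1} ∈ nhds (0 : ι → E) := by
    have : Filter.Tendsto (fun x => ‖f x‖) (nhds 0) (nhds ‖f 0‖) :=
      f.continuous.norm.tendsto 0
    rw [map_zero, norm_zero] at this
    exact this.eventually_lt_const zero_lt_one
  rw [nhds_pi, Filter.mem_pi] at h0
  obtain ⟨I, hI, t, ht, hsub⟩ := h0
  have hvan : ∀ x : ι → E, (∀ i ∈ I, x i = 0) → f x = 0 := by
    intro x hx
    by_contra hne
    have hmem : (f x)⁻¹ • x ∈ I.pi t := fun i hi => by
      simpa [hx i hi] using mem_of_mem_nhds (ht i)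
    have := hsub hmem
    simp [hne] at this
  refine ⟨hI.toFinset, fun x => ?_⟩
  rw [← map_sum, ← sub_eq_zero, ← map_sub]
  refine hvan _ fun i hi => ?_
  rw [Pi.sub_apply, Finset.sum_apply, Finset.sum_eq_single i]
  · simp
  · intro j _ hj
    simp [hj.symm]
  · simp [hi]

/-- The pairing `[f(a_{ij})]` of a matrix-valued linear map with a matrix over its domain. -/
def pairMat {V : Type*} [AddCommGroup V] [Module ℂ V] {r n : ℕ}
    (f : V →ₗ[ℂ] Matrix (Fin n) (Fin n) ℂ) (a : Matrix (Fin r) (Fin r) V) :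
    Matrix (Fin r × Fin n) (Fin r × Fin n) ℂ :=
  Matrix.of fun p q => f (a p.1 q.1) p.2 q.2

section pairMat

variable {V : Type*} [AddCommGroup V] [Module ℂ V] {r m n : ℕ}
  (f : V →ₗ[ℂ] Matrix (Fin n) (Fin n) ℂ)

lemma pairMat_add (a b : Matrix (Fin r) (Fin r) V) :
    pairMat f (a + b) = pairMat f a + pairMat f b := by
  ext p q; simp [pairMat]

lemma pairMat_smul (c : ℂ) (a : Matrix (Fin r) (Fin r) V) :
    pairMat f (c • a) = c • pairMat f a := by
  ext p q; simp [pairMat]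

lemma pairMat_neg (a : Matrix (Fin r) (Fin r) V) : pairMat f (-a) = -pairMat f a := by
  ext p q; simp [pairMat]

lemma pairMat_diagonal {e : V} (he : f e = 1) :
    pairMat f (Matrix.diagonal fun _ : Fin r => e) = 1 := by
  ext ⟨i, p⟩ ⟨j, q⟩
  by_cases h : i = j <;> simp [pairMat, Matrix.diagonal_apply, Matrix.one_apply, h, he]

lemma pairMat_congr (γ : Matrix (Fin r) (Fin m) ℂ) (a : Matrix (Fin r) (Fin r) V) :
    pairMat f (Matrix.of fun i j => ∑ k, ∑ l, (star (γ k i) * γ l j) • a k l) =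
      (Matrix.kroneckerMap (· * ·) γ (1 : Matrix (Fin n) (Fin n) ℂ))ᴴ * pairMat f a *
        Matrix.kroneckerMap (· * ·) γ (1 : Matrix (Fin n) (Fin n) ℂ) := by
  ext ⟨i, p⟩ ⟨j, q⟩
  simp only [pairMat, Matrix.of_apply, map_sum, map_smul, Matrix.sum_apply, Matrix.smul_apply,
    Matrix.mul_apply, Fintype.sum_prod_type, Matrix.conjTranspose_apply, Matrix.kroneckerMap_apply,
    Matrix.one_apply, mul_ite, mul_one, mul_zero, apply_ite star, star_zero, ite_mul, zero_mul,
    Finset.mem_univ, if_true, Finset.sum_mul, smul_eq_mul, Finset.sum_ite_eq']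
  rw [Finset.sum_comm]
  exact Finset.sum_congr rfl fun k _ => Finset.sum_congr rfl fun l _ => by ring

/-- The quadratic form of `pairMat f a` in terms of the compressions `γ* f γ`. -/
lemma dotProduct_pairMat_mulVec (a : Matrix (Fin r) (Fin r) V) (x : Fin r × Fin n → ℂ) :
    star x ⬝ᵥ pairMat f a *ᵥ x =
      ∑ i, ∑ j, ((Matrix.of fun k l => x (l, k))ᴴ * f (a i j) *
        Matrix.of fun k l => x (l, k)) i j := by
  simp only [dotProduct, Matrix.mulVec, Fintype.sum_prod_type, pairMat, Matrix.of_apply,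
    Matrix.mul_apply, Matrix.conjTranspose_apply, Pi.star_apply, Finset.mul_sum, Finset.sum_mul]
  refine Finset.sum_congr rfl fun i _ => ?_
  rw [Finset.sum_comm]
  refine Finset.sum_congr rfl fun j _ => ?_
  rw [Finset.sum_comm]
  exact Finset.sum_congr rfl fun k _ => Finset.sum_congr rfl fun l _ => by ring

end pairMat

lemma posSemidef_of_forall_add_smul_one {ι : Type*} [Fintype ι] [DecidableEq ι]
    {M : Matrix ι ι ℂ} (h : ∀ t : ℝ, 0 < t → (M + (t : ℂ) • (1 : Matrix ι ι ℂ)).PosSemidef) :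
    M.PosSemidef := by
  have hcont : ∀ x : ι → ℂ, Filter.Tendsto
      (fun t : ℝ => star x ⬝ᵥ (M + (t : ℂ) • (1 : Matrix ι ι ℂ)) *ᵥ x)
      (nhdsWithin 0 (Set.Ioi 0)) (nhds (star x ⬝ᵥ M *ᵥ x)) := fun x => by
    have : Continuous (fun t : ℝ => star x ⬝ᵥ (M + (t : ℂ) • (1 : Matrix ι ι ℂ)) *ᵥ x) := by
      fun_prop
    simpa using (this.tendsto 0).mono_left nhdsWithin_le_nhds
  refine Matrix.PosSemidef.of_dotProduct_mulVec_nonneg ?_ fun x => ?_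
  · have h1 := (h 1 one_pos).1
    have h2 : M = (M + ((1 : ℝ) : ℂ) • (1 : Matrix ι ι ℂ)) - 1 := by simp
    rw [h2]
    exact h1.sub Matrix.isHermitian_one
  · refine ge_of_tendsto (hcont x) ?_
    filter_upwards [self_mem_nhdsWithin] with t ht
    exact (h t ht).dotProduct_mulVec_nonneg x

lemma eq_zero_of_posSemidef_neg {ι : Type*} [Fintype ι]
    {M : Matrix ι ι ℂ} (h : M.PosSemidef) (h' : (-M).PosSemidef) : M = 0 := by
  have := h.trace_nonneg
  have h2 := h'.trace_nonneg
  rw [Matrix.trace_neg] at h2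
  exact h.trace_eq_zero_iff.1 (le_antisymm (neg_nonneg.1 h2) this)

lemma map_star_of_mem_CS {A : MOUS} {n : ℕ} {ψ : MState A n} (hψ : ψ ∈ CS A n) (a : A.carrier) :
    ψ (star a) = (ψ a)ᴴ := by
  have key : ∀ b : A.carrier, star b = b → (ψ b)ᴴ = ψ b := by
    intro b hb
    obtain ⟨t, -, hp⟩ := A.orderUnit b hb
    have hh := (hψ.2 1 _ hp).1
    have e : ((t : ℂ) • (1 : Matrix (Fin n) (Fin n) ℂ) - ψ b).IsHermitian := by
      ext p q
      have := congrFun (congrFun hh (0, p)) (0, q)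
      simpa [mpair, hψ.1] using this
    have e2 : ((t : ℂ) • (1 : Matrix (Fin n) (Fin n) ℂ)).IsHermitian := by
      simp [Matrix.IsHermitian, Matrix.conjTranspose_smul]
    have := e2.sub e
    rwa [sub_sub_cancel] at this
  have h1 := key (a + star a) (by simp [add_comm])
  have h2 := key (Complex.I • (a - star a)) (by
    rw [star_smul, star_sub, star_star, ← neg_sub a, smul_neg]; simp)
  simp only [map_add, map_smul, map_sub, Matrix.conjTranspose_add, Matrix.conjTranspose_sub,
    Matrix.conjTranspose_smul] at h1 h2
  ext i j
  have e1 := congrFun (congrFun h1 i) j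
  have e2 := congrFun (congrFun h2 i) j
  simp only [Matrix.add_apply, Matrix.sub_apply, Matrix.smul_apply, Complex.star_def,
    Complex.conj_I, smul_eq_mul] at e1 e2
  have e3 : -((ψ a)ᴴ i j - (ψ (star a))ᴴ i j) = ψ a i j - ψ (star a) i j :=
    mul_left_cancel₀ Complex.I_ne_zero (by linear_combination e2)
  linear_combination (1/2 : ℂ) * (-e1 + e3)

/-- The compression of `θ` by a scalar matrix `γ`, that is, `γ* θ γ`. -/
def conjBy {A : MOUS} {r n : ℕ} (γ : Matrix (Fin r) (Fin n) ℂ) (θ : MState A r) : MState A n :=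
  matComb (k := 1) (ns := fun _ => r) (fun _ => θ) fun _ => γ

lemma conjBy_apply {A : MOUS} {r n : ℕ} (γ : Matrix (Fin r) (Fin n) ℂ) (θ : MState A r)
    (a : A.carrier) : conjBy γ θ a = γᴴ * θ a * γ := by
  simp [conjBy, matComb]

/-- The maps `V → Mₙ(ℂ)` of the form `γ* ψ γ` with `ψ` in some `K r`. -/
def compressions {A : MOUS} (K : ∀ n : ℕ, Set (MState A n)) (n : ℕ) : Set (MState A n) :=
  {θ | ∃ (r : ℕ) (ψ : MState A r) (γ : Matrix (Fin r) (Fin n) ℂ), ψ ∈ K r ∧ conjBy γ ψ = θ}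

/-- The convex cone generated by the compressions of the members of `K`. -/
def compressionCone {A : MOUS} (K : ∀ n : ℕ, Set (MState A n)) (n : ℕ) :
    AddSubmonoid (MState A n) :=
  AddSubmonoid.closure (compressions K n)

section compressionCone

variable {A : MOUS} {K : ∀ n : ℕ, Set (MState A n)} {n : ℕ}

lemma smul_mem_compressionCone {t : ℝ} (ht : 0 ≤ t) {θ : MState A n}
    (hθ : θ ∈ compressionCone K n) : (t : ℂ) • θ ∈ compressionCone K n := by
  induction hθ using AddSubmonoid.closure_induction with
  | mem x hx =>
    obtain ⟨r, ψ, γ, hψ, rfl⟩ := hx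
    refine AddSubmonoid.subset_closure ⟨r, ψ, ((√t : ℝ) : ℂ) • γ, hψ, ?_⟩
    ext1 a
    have : (t : ℂ) = (√t : ℝ) * (√t : ℝ) := by
      rw [← Complex.ofReal_mul, Real.mul_self_sqrt ht]
    rw [LinearMap.smul_apply, conjBy_apply, conjBy_apply, this, Matrix.conjTranspose_smul,
      Matrix.smul_mul, Matrix.smul_mul, Matrix.mul_smul, smul_smul, Complex.star_def,
      Complex.conj_ofReal]
  | zero => rw [smul_zero]; exact zero_mem _
  | add x y _ _ hx hy => rw [smul_add]; exact add_mem hx hy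

lemma exists_matComb_of_mem_compressionCone {θ : MState A n} (hθ : θ ∈ compressionCone K n) :
    ∃ (k : ℕ) (ns : Fin k → ℕ) (φ : ∀ i, MState A (ns i))
      (γ : ∀ i, Matrix (Fin (ns i)) (Fin n) ℂ), (∀ i, φ i ∈ K (ns i)) ∧ θ = matComb φ γ := by
  obtain ⟨l, hl, rfl⟩ := AddSubmonoid.exists_list_of_mem_closure hθ
  have h : ∀ i : Fin l.length, l.get i ∈ compressions K n := fun i => hl _ (l.get_mem i)
  choose ns φ γ hφ hγ using h
  refine ⟨l.length, ns, φ, γ, hφ, ?_⟩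
  ext1 a
  have : l.sum = ∑ i, l.get i := by
    conv_lhs => rw [← List.ofFn_get l, List.sum_ofFn]
  rw [this, LinearMap.sum_apply]
  exact Finset.sum_congr rfl fun i _ => by
    rw [← hγ i, conjBy_apply]

lemma apply_one_posSemidef (hK : IsMatrixConvexSubset A K) {θ : MState A n}
    (hθ : θ ∈ compressionCone K n) : (θ A.one).PosSemidef := by
  obtain ⟨k, ns, φ, γ, hφ, rfl⟩ := exists_matComb_of_mem_compressionCone hθ
  refine Matrix.posSemidef_sum _ fun i _ => ?_
  rw [(hK.1 _ (hφ i)).1, Matrix.mul_one]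
  exact Matrix.posSemidef_conjTranspose_mul_self _

lemma conjBy_invSqrt_mem (hK : IsMatrixConvexSubset A K) {θ : MState A n}
    (hθ : θ ∈ compressionCone K n) (hdet : IsUnit (θ A.one).det) :
    conjBy (invSqrt (θ A.one)) θ ∈ K n := by
  have hpos := apply_one_posSemidef hK hθ
  have hone := invSqrt_conj hpos hdet
  generalize invSqrt (θ A.one) = R at hone ⊢
  obtain ⟨k, ns, φ, γ, hφ, rfl⟩ := exists_matComb_of_mem_compressionCone hθ
  have e : ∀ a, conjBy R (matComb φ γ) a = matComb φ (fun i => γ i * R) a := fun a => by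
    rw [conjBy_apply]
    simp [matComb, Matrix.mul_sum, Matrix.sum_mul, Matrix.conjTranspose_mul, Matrix.mul_assoc]
  rw [LinearMap.ext e]
  refine hK.2 n k ns φ _ hφ ?_
  rw [← hone, ← conjBy_apply, e]
  refine Finset.sum_congr rfl fun i _ => ?_
  rw [(hK.1 _ (hφ i)).1, Matrix.mul_one]

/-- A unital map in the closure of the cone generated by `K` belongs to `K`. -/
lemma mem_of_mem_closure_compressionCone (hK : IsMatrixConvexSubset A K)
    (hclosed : @IsClosed _ (lmTop A n) (K n)) {ψ : MState A n} (hψ : ψ A.one = 1)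
    (h : ψ ∈ @closure _ (lmTop A n) (compressionCone K n)) : ψ ∈ K n := by
  let _ : TopologicalSpace (MState A n) := lmTop A n
  have hind : Topology.IsInducing
      (fun φ : MState A n => (φ : A.carrier → Matrix (Fin n) (Fin n) ℂ)) := ⟨rfl⟩
  have heval : ∀ a : A.carrier, Continuous fun φ : MState A n => φ a := fun a =>
    (continuous_apply a).comp hind.continuous
  have : (nhdsWithin ψ (compressionCone K n : Set (MState A n))).NeBot :=
    mem_closure_iff_nhdsWithin_neBot.1 h
  have hev : ∀ a, Filter.Tendsto (fun θ : MState A n => θ a)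
      (nhdsWithin ψ (compressionCone K n)) (nhds (ψ a)) := fun a =>
    ((heval a).tendsto ψ).mono_left nhdsWithin_le_nhds
  have hR : Filter.Tendsto (fun θ : MState A n => invSqrt (θ A.one))
      (nhdsWithin ψ (compressionCone K n)) (nhds 1) := by
    refine tendsto_invSqrt_one.comp (tendsto_nhdsWithin_iff.2 ⟨hψ ▸ hev A.one, ?_⟩)
    filter_upwards [self_mem_nhdsWithin] with θ hθ using apply_one_posSemidef hK hθ
  have hlim : Filter.Tendsto (fun θ : MState A n => conjBy (invSqrt (θ A.one)) θ)
      (nhdsWithin ψ (compressionCone K n)) (nhds ψ) := by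
    rw [hind.tendsto_nhds_iff, tendsto_pi_nhds]
    intro a
    have hstar : Filter.Tendsto (fun θ : MState A n => (invSqrt (θ A.one))ᴴ)
        (nhdsWithin ψ (compressionCone K n)) (nhds 1) := by
      have := ((continuous_id
        (X := Matrix (Fin n) (Fin n) ℂ)).matrix_conjTranspose.tendsto 1).comp hR
      simpa [Function.comp_def] using this
    simpa [Function.comp_def, conjBy_apply] using (hstar.mul (hev a)).mul hR
  refine hclosed.mem_of_tendsto hlim ?_
  have hdet : Filter.Tendsto (fun θ : MState A n => (θ A.one).det)
      (nhdsWithin ψ (compressionCone K n)) (nhds 1) := by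
    have := ((continuous_id (X := Matrix (Fin n) (Fin n) ℂ)).matrix_det.tendsto (ψ A.one)).comp
      (hev A.one)
    simpa [hψ, Function.comp_def] using this
  filter_upwards [self_mem_nhdsWithin, hdet.eventually_ne one_ne_zero] with θ hθ hd
  exact conjBy_invSqrt_mem hK hθ (isUnit_iff_ne_zero.2 hd)

/-- Separation of a linear map from a closed convex cone by an element of `Mₙ(V)`. -/
lemma exists_matrix_separating {C : AddSubmonoid (MState A n)}
    (hC : ∀ t : ℝ, 0 ≤ t → ∀ θ ∈ C, (t : ℂ) • θ ∈ C) {ψ : MState A n}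
    (hψ : ψ ∉ @closure _ (lmTop A n) (C : Set (MState A n))) :
    ∃ a : Matrix (Fin n) (Fin n) A.carrier,
      (∀ θ ∈ C, 0 ≤ (∑ i, ∑ j, θ (a i j) i j).re) ∧ (∑ i, ∑ j, ψ (a i j) i j).re < 0 := by
  classical
  let toFn : MState A n → (A.carrier → Fin n → Fin n → ℂ) := fun φ a i j => φ a i j
  have hmem : toFn ψ ∉ closure (toFn '' C) := fun h => hψ (closure_induced.2 h)
  have hconv : Convex ℝ (toFn '' (C : Set (MState A n))) := by
    rintro _ ⟨x, hx, rfl⟩ _ ⟨y, hy, rfl⟩ s t hs ht -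
    refine ⟨(s : ℂ) • x + (t : ℂ) • y, add_mem (hC s hs x hx) (hC t ht y hy), ?_⟩
    funext a i j
    simp [toFn]
  obtain ⟨f, u, hf, hu⟩ := RCLike.geometric_hahn_banach_closed_point (𝕜 := ℂ)
    hconv.closure isClosed_closure hmem
  have hf' : ∀ θ ∈ C, (f (toFn θ)).re < u := fun θ hθ => hf _ (subset_closure ⟨θ, hθ, rfl⟩)
  have hu0 : 0 < u := by
    have h0 := hf' 0 (zero_mem _)
    have : toFn 0 = 0 := rfl
    simpa [this] using h0
  have hneg : ∀ θ ∈ C, (f (toFn θ)).re ≤ 0 := by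
    intro θ hθ
    by_contra! hpos
    have h1 := hf' _ (hC (u / (f (toFn θ)).re) (div_pos hu0 hpos).le θ hθ)
    have h2 : toFn (((u / (f (toFn θ)).re : ℝ) : ℂ) • θ) =
        ((u / (f (toFn θ)).re : ℝ) : ℂ) • toFn θ := rfl
    rw [h2, map_smul, smul_eq_mul, Complex.re_ofReal_mul, div_mul_cancel₀ _ hpos.ne'] at h1
    exact lt_irrefl _ h1
  obtain ⟨F, hF⟩ := exists_finset_eq_sum_single f
  let a : Matrix (Fin n) (Fin n) A.carrier := Matrix.of fun i j =>
    ∑ b ∈ F, (-f (Pi.single b (Pi.single i (Pi.single j 1)))) • b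
  have hrep : ∀ θ : MState A n, ∑ i, ∑ j, θ (a i j) i j = -f (toFn θ) := by
    intro θ
    have hexp : ∀ x : Fin n → Fin n → ℂ,
        x = ∑ i, ∑ j, x i j • (Pi.single i (Pi.single j 1) : Fin n → Fin n → ℂ) := by
      intro x
      funext p q
      rw [Finset.sum_apply, Finset.sum_apply, Finset.sum_eq_single p, Finset.sum_apply,
        Finset.sum_apply, Finset.sum_eq_single q]
      · simp
      · intro j _ hj
        simp [hj.symm]
      · simp
      · intro i _ hi
        simp [hi.symm]
      · simp
    have hlin : ∀ (b : A.carrier) (x : Fin n → Fin n → ℂ), f (Pi.single b x) =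
        ∑ i, ∑ j, x i j * f (Pi.single b (Pi.single i (Pi.single j 1))) := by
      intro b x
      have := congrArg (f ∘L ContinuousLinearMap.single ℂ (fun _ => Fin n → Fin n → ℂ) b) (hexp x)
      simpa only [map_sum, map_smul, smul_eq_mul, ContinuousLinearMap.comp_apply,
        ContinuousLinearMap.single_apply] using this
    rw [hF (toFn θ), Finset.sum_congr rfl fun b _ => hlin b _]
    simp only [a, Matrix.of_apply, map_sum, map_smul, Matrix.sum_apply, Matrix.smul_apply,
      smul_eq_mul, neg_mul, Finset.sum_neg_distrib]
    rw [neg_inj, Finset.sum_comm (s := F)]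
    refine Finset.sum_congr rfl fun i _ => ?_
    rw [Finset.sum_comm (s := F)]
    exact Finset.sum_congr rfl fun j _ => Finset.sum_congr rfl fun b _ => mul_comm _ _
  refine ⟨a, fun θ hθ => ?_, ?_⟩
  · rw [hrep, Complex.neg_re]
    exact neg_nonneg.2 (hneg θ hθ)
  · rw [hrep, Complex.neg_re]
    exact neg_lt_zero.2 (hu0.trans hu)

/-- The bipolar theorem for compact matrix convex sets. -/
lemma mem_of_forall_posSemidef (hK : IsMatrixConvexSubset A K)
    (hclosed : @IsClosed _ (lmTop A n) (K n)) {ψ : MState A n} (hψ : ψ A.one = 1)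
    (h : ∀ a : Matrix (Fin n) (Fin n) A.carrier,
      (∀ r, ∀ θ ∈ K r, (pairMat θ a).PosSemidef) → (pairMat ψ a).PosSemidef)
    (hstar : ∀ a, ψ (star a) = (ψ a)ᴴ) : ψ ∈ K n := by
  by_contra hnot
  obtain ⟨a, ha, hlt⟩ := exists_matrix_separating
    (fun t ht θ hθ => smul_mem_compressionCone ht hθ)
    (fun hcl => hnot (mem_of_mem_closure_compressionCone hK hclosed hψ hcl))
  have hsymm : ∀ {r : ℕ} (θ : MState A r), (∀ b, θ (star b) = (θ b)ᴴ) →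
      pairMat θ (a + aᴴ) = pairMat θ a + (pairMat θ a)ᴴ := by
    intro r θ hθ
    rw [pairMat_add]
    congr 1
    ext p q
    simp [pairMat, hθ]
  have hre : ∀ {r : ℕ} (θ : MState A r), (∀ b, θ (star b) = (θ b)ᴴ) → ∀ x,
      star x ⬝ᵥ pairMat θ (a + aᴴ) *ᵥ x =
        ((2 * (star x ⬝ᵥ pairMat θ a *ᵥ x).re : ℝ) : ℂ) := by
    intro r θ hθ x
    have : star x ⬝ᵥ (pairMat θ a)ᴴ *ᵥ x = star (star x ⬝ᵥ pairMat θ a *ᵥ x) := by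
      rw [Matrix.star_dotProduct, Matrix.star_mulVec, Matrix.conjTranspose_conjTranspose,
        ← Matrix.dotProduct_mulVec]
    rw [hsymm θ hθ, Matrix.add_mulVec, dotProduct_add, this, Complex.star_def, Complex.add_conj]
  have hpos := h (a + aᴴ) fun r θ hθ => by
    have hθstar := map_star_of_mem_CS (hK.1 r hθ)
    refine Matrix.PosSemidef.of_dotProduct_mulVec_nonneg ?_ fun x => ?_
    · rw [hsymm θ hθstar]
      exact Matrix.isHermitian_add_transpose_self _
    · rw [hre θ hθstar, dotProduct_pairMat_mulVec]
      have := ha _ (AddSubmonoid.subset_closure ⟨r, θ, Matrix.of fun k l => x (l, k), hθ, rfl⟩)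
      simp only [conjBy_apply] at this
      exact_mod_cast mul_nonneg zero_le_two this
  have hx := hpos.dotProduct_mulVec_nonneg fun p => if p.1 = p.2 then 1 else 0
  rw [hre ψ hstar, dotProduct_pairMat_mulVec] at hx
  have hone : (Matrix.of fun k l : Fin n => if l = k then (1 : ℂ) else 0) = 1 := by
    ext k l; simp [Matrix.one_apply, eq_comm]
  simp only [hone, Matrix.conjTranspose_one, one_mul, mul_one] at hx
  have : (0 : ℝ) ≤ 2 * (∑ i, ∑ j, ψ (a i j) i j).re := by exact_mod_cast hx
  linarith

end compressionCone

section Restriction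

variable (A : MOUS) (K : ∀ n : ℕ, Set (MState A n))

/-- The restriction map sending `a ∈ V` to the function `ψ ↦ ψ(a)` on `K`. -/
def restrictTo : A.carrier →ₗ[ℂ] (∀ r, K r → Matrix (Fin r) (Fin r) ℂ) :=
  LinearMap.pi fun _ => LinearMap.pi fun ψ => ψ.1

/-- The members of `K` as maps on the space of restrictions to `K`. -/
def evalAt {r : ℕ} (ψ : K r) : LinearMap.range (restrictTo A K) →ₗ[ℂ] Matrix (Fin r) (Fin r) ℂ :=
  (LinearMap.proj ψ ∘ₗ LinearMap.proj r) ∘ₗ (LinearMap.range (restrictTo A K)).subtype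

variable {A K}

@[simp]
lemma evalAt_rangeRestrict {r : ℕ} (ψ : K r) (a : A.carrier) :
    evalAt A K ψ ((restrictTo A K).rangeRestrict a) = ψ.1 a := rfl

lemma ext_evalAt {v w : LinearMap.range (restrictTo A K)}
    (h : ∀ r (ψ : K r), evalAt A K ψ v = evalAt A K ψ w) : v = w :=
  Subtype.ext <| funext fun r => funext fun ψ => h r ψ

lemma star_mem_range_restrictTo (hK : ∀ n, K n ⊆ CS A n)
    (w : LinearMap.range (restrictTo A K)) :
    (star w.1 : ∀ r, K r → Matrix (Fin r) (Fin r) ℂ) ∈ LinearMap.range (restrictTo A K) := by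
  obtain ⟨_, a, rfl⟩ := w
  refine ⟨star a, ?_⟩
  funext r ψ
  exact map_star_of_mem_CS (hK r ψ.2) a

/-- The pointwise involution on the space of restrictions to `K`. -/
@[reducible]
def restrictionStar (hK : ∀ n, K n ⊆ CS A n) :
    StarAddMonoid (LinearMap.range (restrictTo A K)) where
  star w := ⟨star w.1, star_mem_range_restrictTo hK w⟩
  star_involutive w := Subtype.ext (star_star w.1)
  star_add v w := Subtype.ext (star_add v.1 w.1)

/-- The matrix order unit space of restrictions to `K` of the elements of `V`. -/
def restrictionSpace (hK : ∀ n, K n ⊆ CS A n) : MOUS where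
  carrier := LinearMap.range (restrictTo A K)
  sam := restrictionStar hK
  sm :=
    let _ := restrictionStar hK
    ⟨fun c w => Subtype.ext (star_smul c w.1)⟩
  one := (restrictTo A K).rangeRestrict A.one
  pos n := {w | ∀ r (ψ : K r), (pairMat (evalAt A K ψ) w).PosSemidef}
  pos_add n v hv w hw r ψ := by
    rw [pairMat_add]
    exact (hv r ψ).add (hw r ψ)
  pos_smul n t ht v hv r ψ := by
    rw [pairMat_smul]
    exact (hv r ψ).smul (Complex.zero_le_real.2 ht)
  pos_star n v hv := by
    refine Matrix.ext fun i j => ext_evalAt fun r ψ => ?_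
    ext p q
    exact congrFun (congrFun (hv r ψ).1 (i, p)) (j, q)
  pos_congr n m γ v hv r ψ := by
    rw [pairMat_congr]
    exact (hv r ψ).conjTranspose_mul_mul_same _
  proper v hv hv' := by
    refine Matrix.ext fun i j => ext_evalAt fun r ψ => ?_
    have h := hv' r ψ
    rw [pairMat_neg] at h
    have h0 := eq_zero_of_posSemidef_neg (hv r ψ) h
    ext p q
    exact congrFun (congrFun h0 (i, p)) (j, q)
  unit_pos n r ψ := by
    rw [pairMat_diagonal _ (by simpa using (hK r ψ.2).1)]
    exact Matrix.PosSemidef.one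
  orderUnit := by
    intro v hv
    obtain ⟨a, rfl⟩ := (restrictTo A K).surjective_rangeRestrict v
    have ha : (restrictTo A K).rangeRestrict ((1 / 2 : ℂ) • (a + star a)) =
        (restrictTo A K).rangeRestrict a := by
      refine ext_evalAt fun r ψ => ?_
      have h1 : (ψ.1 a)ᴴ = ψ.1 a := congrArg (evalAt A K ψ) hv
      simp only [evalAt_rangeRestrict, map_smul, map_add, map_star_of_mem_CS (hK r ψ.2), h1]
      rw [← two_smul ℂ, smul_smul]
      norm_num
    obtain ⟨t, ht, hp⟩ := A.orderUnit ((1 / 2 : ℂ) • (a + star a)) (by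
      simp [star_smul, add_comm])
    refine ⟨t, ht, fun r ψ => ?_⟩
    have h := (hK r ψ.2).2 1 _ hp
    have e : (Matrix.of fun _ _ => (t : ℂ) • (restrictTo A K).rangeRestrict A.one -
          (restrictTo A K).rangeRestrict ((1 / 2 : ℂ) • (a + star a)) :
          Matrix (Fin 1) (Fin 1) (LinearMap.range (restrictTo A K))) =
        mapMat (restrictTo A K).rangeRestrict
          (Matrix.of fun _ _ => (t : ℂ) • A.one - (1 / 2 : ℂ) • (a + star a)) := by
      refine Matrix.ext fun _ _ => ?_
      simp only [mapMat, Matrix.of_apply, map_sub, map_smul]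
    rw [← ha, e]
    exact h
  archimedean n v h r ψ := by
    refine posSemidef_of_forall_add_smul_one fun t ht => ?_
    have := h t ht r ψ
    rwa [pairMat_add, pairMat_smul, pairMat_diagonal _ (by simpa using (hK r ψ.2).1)] at this

end Restriction

/-- Proposition 3.8 of the paper.  Let `(V, 1)` be a matrix order unit
space and `K = (K_n)` a compact matrix convex subset of `CS(V)`.  View the elements of
`V` as matrix affine mappings from `CS(V)` to `ℂ` and let `W` consist of their
restrictions to `K`, with `φ` the restriction mapping.  Then `(W, φ(1))` is a matrix
order unit space and `K = φᶜ(CS(W))`. -/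
theorem quotient_by_compact_matrix_convex_exists (A : MOUS)
    (K : ∀ n : ℕ, Set (MState A n))
    (hK : IsMatrixConvexSubset A K)
    (hcpt : ∀ n, @IsCompact _ (lmTop A n) (K n)) :
    ∃ (W : MOUS) (φ : A.carrier →ₗ[ℂ] W.carrier), IsQuotientBy A K W φ := by
  have hmem : ∀ n (a : Matrix (Fin n) (Fin n) A.carrier),
      (∀ r (ψ : K r), (mpair ψ.1 a).PosSemidef) ↔ ∀ r, ∀ ψ ∈ K r, (mpair ψ a).PosSemidef :=
    fun n a => ⟨fun h r ψ hψ => h r ⟨ψ, hψ⟩, fun h r ψ => h r ψ.1 ψ.2⟩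
  refine ⟨restrictionSpace hK.1, (restrictTo A K).rangeRestrict, ⟨rfl, fun n v hv r ψ => ?_⟩,
    (restrictTo A K).surjective_rangeRestrict, fun n a => ⟨fun h r ψ hψ => ?_, fun h => ?_⟩,
    hmem, fun n => Set.Subset.antisymm (fun ψ hψ => ?_) ?_⟩
  · exact (hK.1 r ψ.2).2 n v hv
  · ext p q
    have := congrArg (evalAt A K ⟨ψ, hψ⟩) (congrFun (congrFun h p.1) q.1)
    exact congrFun (congrFun this p.2) q.2
  · refine Matrix.ext fun i j => ext_evalAt fun r ψ => ?_
    ext p q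
    exact congrFun (congrFun (h r ψ.1 ψ.2) (i, p)) (j, q)
  · exact ⟨evalAt A K ⟨ψ, hψ⟩, ⟨(hK.1 n hψ).1, fun r v hv => hv n ⟨ψ, hψ⟩⟩, rfl⟩
  · rintro _ ⟨ψ, hψ, rfl⟩
    have hclosed : @IsClosed _ (lmTop A n) (K n) := by
      let _ : TopologicalSpace (MState A n) := lmTop A n
      have hemb : Topology.IsEmbedding
          (fun φ : MState A n => (φ : A.carrier → Matrix (Fin n) (Fin n) ℂ)) :=
        ⟨⟨rfl⟩, DFunLike.coe_injective⟩
      have := hemb.t2Space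
      exact (hcpt n).isClosed
    refine mem_of_forall_posSemidef hK hclosed hψ.1 (fun a ha => ?_) fun a => ?_
    · exact hψ.2 n (mapMat (restrictTo A K).rangeRestrict a) fun r θ => ha r θ.1 θ.2
    · refine Eq.trans (congrArg ψ ?_) (map_star_of_mem_CS hψ _)
      refine ext_evalAt fun r θ => ?_
      exact map_star_of_mem_CS (hK.1 r θ.2) a

end
end

section
/- Let N be a matrix bridge between quantized metric spaces (V₁, L₁) and (V₂, L₂), and define L_n(a, b) = max{L_{1,n}(a), L_{2,n}(b), N_n(a, b)} for a ∈ M_n(V₁) and b ∈ M_n(V₂). Then L = (L_n) is a matrix Lip-norm on (V₁ ⊕ V₂, (1, 1)) which induces L₁ and L₂ via the coordinate projections π₁ and π₂; moreover, if L₁ and L₂ are lower semicontinuous, then so is L. -/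
open scoped ComplexOrder

noncomputable section

/-- A matrix bridge between two quantized metric spaces `(V₁, L₁)` and `(V₂, L₂)`:
a matrix seminorm on `V₁ ⊕ V₂` which is norm-continuous, *-invariant, vanishes at
`(1,1)` but not at `(1,0)`, and approximately dominates each side's Lip-norm. -/
structure IsMatrixBridge (A B : MOUS)
    (LA : ∀ n : ℕ, Matrix (Fin n) (Fin n) A.carrier → ℝ)
    (LB : ∀ n : ℕ, Matrix (Fin n) (Fin n) B.carrier → ℝ)
    (N : ∀ n : ℕ, Matrix (Fin n) (Fin n) (A.prod B).carrier → ℝ) : Prop where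
  seminorm : IsMatrixSeminorm (A.prod B) N
  matrix_continuous : ∀ (n : ℕ) (a : Matrix (Fin n) (Fin n) (A.prod B).carrier) (ε : ℝ),
    0 < ε → ∃ δ : ℝ, 0 < δ ∧ ∀ b, (A.prod B).matNorm (b - a) < δ → |N n b - N n a| < ε
  star_eq : ∀ n v, N n (Matrix.conjTranspose v) = N n v
  unit_zero : N 1 (Matrix.of fun _ _ => ((A.one, B.one) : (A.prod B).carrier)) = 0
  unit_ne : N 1 (Matrix.of fun _ _ => ((A.one, 0) : (A.prod B).carrier)) ≠ 0
  approx₁ : ∀ (n : ℕ) (a : Matrix (Fin n) (Fin n) A.carrier) (ε : ℝ), 0 < ε →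
    ∃ b : Matrix (Fin n) (Fin n) B.carrier,
      max (LB n b) (N n (Matrix.of fun i j => ((a i j, b i j) : (A.prod B).carrier)))
        ≤ LA n a + ε
  approx₂ : ∀ (n : ℕ) (b : Matrix (Fin n) (Fin n) B.carrier) (ε : ℝ), 0 < ε →
    ∃ a : Matrix (Fin n) (Fin n) A.carrier,
      max (LA n a) (N n (Matrix.of fun i j => ((a i j, b i j) : (A.prod B).carrier)))
        ≤ LB n b + ε

/-! ### Matrix order and matrix norm bounds -/

/-- The `1 × 1` matrix with a given entry. -/
abbrev mat1 {V : Type} (x : V) : Matrix (Fin 1) (Fin 1) V := Matrix.of fun _ _ => x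

namespace MOUS

variable {A B : MOUS}

theorem congr_mem {ι κ : Type} [Fintype ι] {n m : ℕ} (e : ι ≃ Fin n) (f : κ ≃ Fin m)
    (γ : Matrix ι κ ℂ) {v : Matrix ι ι A.carrier} (hv : Matrix.reindex e e v ∈ A.pos n) :
    Matrix.reindex f f (Matrix.of fun i j => ∑ k, ∑ l, (star (γ k i) * γ l j) • v k l)
      ∈ A.pos m := by
  convert A.pos_congr n m (Matrix.reindex e f γ) _ hv using 1
  ext i j
  simp only [Matrix.reindex_apply, Matrix.submatrix_apply, Matrix.of_apply]
  rw [← Equiv.sum_comp e]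
  refine Finset.sum_congr rfl fun k _ => ?_
  rw [← Equiv.sum_comp e]
  simp

theorem diag_mem {ι : Type} [Fintype ι] [DecidableEq ι] {n : ℕ} (e : ι ≃ Fin n)
    (d : ι → ℂ) {v : Matrix ι ι A.carrier} (hv : Matrix.reindex e e v ∈ A.pos n) :
    Matrix.reindex e e (Matrix.of fun i j => (star (d i) * d j) • v i j) ∈ A.pos n := by
  have h : (Matrix.of fun i j => (star (d i) * d j) • v i j) = Matrix.of fun i j =>
      ∑ k, ∑ l, (star (Matrix.diagonal d k i) * Matrix.diagonal d l j) • v k l := by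
    ext i j
    rw [Matrix.of_apply, Matrix.of_apply, Finset.sum_eq_single i, Finset.sum_eq_single j]
    · simp
    · intro l _ hl
      simp [Matrix.diagonal_apply_ne _ hl]
    · simp
    · intro k _ hk
      simp [Matrix.diagonal_apply_ne _ hk]
    · simp
  rw [h]
  exact congr_mem e e (Matrix.diagonal d) hv

theorem one_mem (A : MOUS) : mat1 A.one ∈ A.pos 1 := by
  convert A.unit_pos 1 using 1
  ext i j
  simp [Subsingleton.elim i j]

/-- `A.Bd v t` says that the matrix `[[t1, v], [v*, t1]]` is positive. -/
def Bd (A : MOUS) {n : ℕ} (v : Matrix (Fin n) (Fin n) A.carrier) (t : ℝ) : Prop :=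
  Matrix.reindex finSumFinEquiv finSumFinEquiv
    (Matrix.fromBlocks ((t : ℂ) • A.unitMat n) v v.conjTranspose ((t : ℂ) • A.unitMat n))
      ∈ A.pos (n + n)

theorem bd_zero (A : MOUS) (n : ℕ) {t : ℝ} (ht : 0 ≤ t) :
    A.Bd (0 : Matrix (Fin n) (Fin n) A.carrier) t := by
  unfold Bd
  convert A.pos_smul (n + n) t ht _ (A.unit_pos (n + n)) using 1
  ext i j
  obtain ⟨i, rfl⟩ := finSumFinEquiv.surjective i
  obtain ⟨j, rfl⟩ := finSumFinEquiv.surjective j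
  rcases i with i | i <;> rcases j with j | j <;>
    simp [unitMat, Matrix.diagonal_apply, -finSumFinEquiv_apply_left,
      -finSumFinEquiv_apply_right]

theorem Bd.add {n : ℕ} {v w : Matrix (Fin n) (Fin n) A.carrier} {t s : ℝ}
    (hv : A.Bd v t) (hw : A.Bd w s) : A.Bd (v + w) (t + s) := by
  unfold Bd at *
  convert A.pos_add _ _ hv _ hw using 1
  ext i j
  obtain ⟨i, rfl⟩ := finSumFinEquiv.surjective i
  obtain ⟨j, rfl⟩ := finSumFinEquiv.surjective j
  rcases i with i | i <;> rcases j with j | j <;>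
    simp [add_smul, -finSumFinEquiv_apply_left, -finSumFinEquiv_apply_right]

theorem Bd.mono {n : ℕ} {v : Matrix (Fin n) (Fin n) A.carrier} {t s : ℝ}
    (hv : A.Bd v t) (hts : t ≤ s) : A.Bd v s := by
  simpa using hv.add (A.bd_zero n (sub_nonneg.mpr hts))

theorem Bd.smul {n : ℕ} {v : Matrix (Fin n) (Fin n) A.carrier} {t : ℝ}
    (hv : A.Bd v t) (c : ℂ) : A.Bd (c • v) (‖c‖ * t) := by
  rcases eq_or_ne c 0 with rfl | hc
  · simpa using A.bd_zero n le_rfl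
  have hc' : (‖c‖ : ℂ) ≠ 0 := by simpa using hc
  have h := A.pos_smul _ ‖c‖ (norm_nonneg c) _ (diag_mem finSumFinEquiv
    (Sum.elim (fun _ => star (c / ‖c‖)) (fun _ => 1)) hv)
  unfold Bd
  convert h using 1
  have h1 : (‖c‖ : ℂ) * (c / ‖c‖) = c := by field_simp
  have h2 : (‖c‖ : ℂ) * (star c / ‖c‖) = star c := by field_simp
  have h3 : (c / ‖c‖) * (star c / ‖c‖) = 1 := by
    have : c * star c = ‖c‖ * ‖c‖ := by
      simpa [sq] using Complex.mul_conj' c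
    rw [div_mul_div_comm, this]
    field_simp
  ext i j
  obtain ⟨i, rfl⟩ := finSumFinEquiv.surjective i
  obtain ⟨j, rfl⟩ := finSumFinEquiv.surjective j
  rcases i with i | i <;> rcases j with j | j <;>
    simp [Matrix.diagonal_apply, unitMat, smul_smul, -Complex.coe_smul,
      -finSumFinEquiv_apply_left, -finSumFinEquiv_apply_right] at h1 h2 h3 ⊢
  · simp [h3]
  · rw [h1]
  · rw [h2]

theorem Bd.nonneg {n : ℕ} {v : Matrix (Fin n) (Fin n) A.carrier} {t : ℝ}
    (hv : A.Bd v t) (hA : A.one ≠ 0) (i : Fin n) : 0 ≤ t := by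
  by_contra! ht
  have h := congr_mem finSumFinEquiv (Equiv.refl (Fin 1))
    (Matrix.of fun k _ => if k = Sum.inl i then 1 else 0) hv
  have h' := A.pos_smul _ (-t)⁻¹ (by simpa using ht.le) _ h
  have h3 := A.proper _ A.one_mem (by
    convert h' using 1
    ext i j
    have : (t : ℂ) ≠ 0 := by exact_mod_cast ht.ne
    simp only [Matrix.reindex_apply]
    simp [unitMat, smul_smul, this, -Complex.coe_smul])
  exact hA (congrFun (congrFun h3 0) 0)

theorem bd_of_pos {p : A.carrier} {t : ℝ} (hp : star p = p)
    (h1 : mat1 ((t : ℂ) • A.one - p) ∈ A.pos 1) (h2 : mat1 ((t : ℂ) • A.one + p) ∈ A.pos 1) :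
    A.Bd (mat1 p) t := by
  have k1 := congr_mem (Equiv.refl (Fin 1)) finSumFinEquiv
    (Matrix.of fun _ k => Sum.elim (fun _ => 1) (fun _ => -1) k :
      Matrix (Fin 1) (Fin 1 ⊕ Fin 1) ℂ) h1
  have k2 := congr_mem (Equiv.refl (Fin 1)) finSumFinEquiv
    (Matrix.of fun _ _ => 1 : Matrix (Fin 1) (Fin 1 ⊕ Fin 1) ℂ) h2
  have h := A.pos_smul _ (1 / 2) (by norm_num) _ (A.pos_add _ _ k1 _ k2)
  unfold Bd
  convert h using 1
  ext i j
  obtain ⟨i, rfl⟩ := finSumFinEquiv.surjective i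
  obtain ⟨j, rfl⟩ := finSumFinEquiv.surjective j
  rcases i with i | i <;> rcases j with j | j <;>
    simp [unitMat, Subsingleton.elim i j, hp, -finSumFinEquiv_apply_left,
      -finSumFinEquiv_apply_right] <;> module

theorem bd_prod_iff {n : ℕ} {v : Matrix (Fin n) (Fin n) (A.prod B).carrier} {t : ℝ} :
    (A.prod B).Bd v t ↔ A.Bd (Matrix.of fun i j => (v i j).1) t ∧
      B.Bd (Matrix.of fun i j => (v i j).2) t := by
  unfold Bd
  refine and_congr (iff_of_eq ?_) (iff_of_eq ?_) <;> congr 1 <;> ext i j <;>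
  · obtain ⟨i, rfl⟩ := finSumFinEquiv.surjective i
    obtain ⟨j, rfl⟩ := finSumFinEquiv.surjective j
    rcases i with i | i <;> rcases j with j | j <;>
      simp [unitMat, Matrix.diagonal_apply, -finSumFinEquiv_apply_left,
        -finSumFinEquiv_apply_right] <;>
      first | rfl | (split_ifs <;> rfl)

theorem bd_single {n : ℕ} {x : A.carrier} {t : ℝ} (hx : A.Bd (mat1 x) t) (ht : 0 ≤ t)
    (k l : Fin n) : A.Bd (Matrix.single k l x) t := by
  have h1 := congr_mem finSumFinEquiv finSumFinEquiv
    (Matrix.fromBlocks (Matrix.of fun _ i => if k = i then 1 else 0) 0 0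
      (Matrix.of fun _ i => if l = i then 1 else 0) :
        Matrix (Fin 1 ⊕ Fin 1) (Fin n ⊕ Fin n) ℂ) hx
  have h2 := diag_mem finSumFinEquiv (Sum.elim (fun i => if k = i then 0 else 1)
    (fun i => if l = i then 0 else 1)) (A.bd_zero n ht)
  have h := A.pos_add _ _ h1 _ h2
  unfold Bd
  convert h using 1
  ext i j
  obtain ⟨i, rfl⟩ := finSumFinEquiv.surjective i
  obtain ⟨j, rfl⟩ := finSumFinEquiv.surjective j
  rcases i with i | i <;> rcases j with j | j <;>
    simp [unitMat, Matrix.diagonal_apply, Matrix.single_apply, -Complex.coe_smul,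
      -finSumFinEquiv_apply_left, -finSumFinEquiv_apply_right]
  · by_cases h1 : k = i <;> by_cases h2 : k = j <;> by_cases h3 : i = j <;> simp_all
  · by_cases h1 : k = i <;> by_cases h2 : l = j <;> simp_all
  · by_cases h1 : l = i <;> by_cases h2 : k = j <;> simp_all
  · by_cases h1 : l = i <;> by_cases h2 : l = j <;> by_cases h3 : i = j <;> simp_all

open ComplexStarModule in
theorem bd_of_parts {x : A.carrier} {t s : ℝ}
    (h1 : A.Bd (mat1 (realPart x : A.carrier)) t)
    (h2 : A.Bd (mat1 (imaginaryPart x : A.carrier)) s) :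
    A.Bd (mat1 x) (t + s) := by
  have h := h1.add (h2.smul Complex.I)
  rw [Complex.norm_I, one_mul] at h
  convert h using 1
  ext i j
  exact (realPart_add_I_smul_imaginaryPart x).symm

theorem exists_bd_of_selfAdjoint {p : A.carrier} (hp : star p = p) :
    ∃ t : ℝ, 0 ≤ t ∧ A.Bd (mat1 p) t := by
  obtain ⟨t, ht, h1⟩ := A.orderUnit p hp
  obtain ⟨s, hs, h2⟩ := A.orderUnit (-p) (by simp [hp])
  refine ⟨t + s, by positivity, bd_of_pos hp ?_ ?_⟩
  · convert A.pos_add _ _ h1 _ (A.pos_smul _ s hs.le _ A.one_mem) using 1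
    ext i j
    simp [add_smul]
    abel
  · convert A.pos_add _ _ h2 _ (A.pos_smul _ t ht.le _ A.one_mem) using 1
    ext i j
    simp [add_smul]
    abel

theorem exists_bd_mat1 (x : A.carrier) : ∃ t : ℝ, 0 ≤ t ∧ A.Bd (mat1 x) t := by
  obtain ⟨t, ht, h1⟩ := exists_bd_of_selfAdjoint (realPart x).2
  obtain ⟨s, hs, h2⟩ := exists_bd_of_selfAdjoint (imaginaryPart x).2
  exact ⟨t + s, by positivity, bd_of_parts h1 h2⟩

theorem exists_bd {n : ℕ} (v : Matrix (Fin n) (Fin n) A.carrier) : ∃ t : ℝ, A.Bd v t := by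
  rw [Matrix.matrix_eq_sum_single v]
  refine Finset.sum_induction _ (fun w => ∃ t : ℝ, A.Bd w t)
    (fun _ _ ⟨t, h⟩ ⟨s, h'⟩ => ⟨_, h.add h'⟩) ⟨0, A.bd_zero n le_rfl⟩ fun k _ => ?_
  refine Finset.sum_induction _ (fun w => ∃ t : ℝ, A.Bd w t)
    (fun _ _ ⟨t, h⟩ ⟨s, h'⟩ => ⟨_, h.add h'⟩) ⟨0, A.bd_zero n le_rfl⟩ fun l _ => ?_
  obtain ⟨t, ht, h⟩ := exists_bd_mat1 (v k l)
  exact ⟨t, bd_single h ht k l⟩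

theorem bddBelow_bd (hA : A.one ≠ 0) {n : ℕ} (i : Fin n)
    (v : Matrix (Fin n) (Fin n) A.carrier) : BddBelow {t : ℝ | A.Bd v t} :=
  ⟨0, fun _ ht => Bd.nonneg ht hA i⟩

theorem Bd.matNorm_le (hA : A.one ≠ 0) {n : ℕ} (i : Fin n)
    {v : Matrix (Fin n) (Fin n) A.carrier} {t : ℝ} (h : A.Bd v t) : A.matNorm v ≤ t :=
  csInf_le (bddBelow_bd hA i v) h

theorem matNorm_fst_le (hA : A.one ≠ 0) {n : ℕ} (i : Fin n)
    (v : Matrix (Fin n) (Fin n) (A.prod B).carrier) :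
    A.matNorm (Matrix.of fun i j => (v i j).1) ≤ (A.prod B).matNorm v :=
  csInf_le_csInf (bddBelow_bd hA i _) (exists_bd v) fun _ ht => (bd_prod_iff.mp ht).1

theorem matNorm_snd_le (hB : B.one ≠ 0) {n : ℕ} (i : Fin n)
    (v : Matrix (Fin n) (Fin n) (A.prod B).carrier) :
    B.matNorm (Matrix.of fun i j => (v i j).2) ≤ (A.prod B).matNorm v :=
  csInf_le_csInf (bddBelow_bd hB i _) (exists_bd v) fun _ ht => (bd_prod_iff.mp ht).2

/-! ### Matrix states -/

theorem Bd.norm_state_le {x : A.carrier} {t : ℝ} (h : A.Bd (mat1 x) t) {m : ℕ}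
    {φ : MState A m} (hφ : φ ∈ CS A m) (k l : Fin m) : ‖φ x k l‖ ≤ t := by
  have h1 := (hφ.2 _ _ h).submatrix
    ![(finSumFinEquiv (Sum.inl 0), k), (finSumFinEquiv (Sum.inr 0), l)]
  have h2 := h1.det_nonneg
  rw [Matrix.det_fin_two] at h2
  have h3 := h1.diag_nonneg (i := 0)
  have h4 := h1.isHermitian.apply 1 0
  simp [mpair, unitMat, hφ.1,
    -finSumFinEquiv_apply_left, -finSumFinEquiv_apply_right] at h2 h3 h4
  rw [← h4, Complex.mul_conj'] at h2
  have h5 : ‖φ x k l‖ ^ 2 ≤ t * t := by exact_mod_cast h2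
  nlinarith [norm_nonneg (φ x k l)]

/-- The matrix state of rank one attached to a positive unital real functional. -/
theorem exists_state_of_functional (g : selfAdjoint A.carrier →ₗ[ℝ] ℝ)
    (hg : ∀ u : selfAdjoint A.carrier, mat1 (u : A.carrier) ∈ A.pos 1 → 0 ≤ g u)
    (h1 : ∀ u : selfAdjoint A.carrier, (u : A.carrier) = A.one → g u = 1) :
    ∃ φ ∈ CS A 1, ∀ u : selfAdjoint A.carrier, φ (u : A.carrier) 0 0 = g u := by
  let φ₀ : A.carrier →ₗ[ℂ] ℂ :=
    Module.Dual.extendRCLike (𝕜 := ℂ) (g ∘ₗ realPart)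
  have hφ₀ : ∀ x, φ₀ x = (g (realPart x) : ℂ) + Complex.I * g (imaginaryPart x) := by
    intro x
    simp [φ₀, Module.Dual.extendRCLike_apply, sub_eq_add_neg]
  have hsa : ∀ u : selfAdjoint A.carrier, φ₀ u = g u := by
    intro u
    simp [hφ₀]
  have hstar : ∀ x, φ₀ (star x) = star (φ₀ x) := by
    intro x
    conv_lhs => rw [← realPart_add_I_smul_imaginaryPart x]
    rw [star_add, star_smul, (realPart x).2.star_eq, (imaginaryPart x).2.star_eq, map_add,
      map_smul, hsa, hsa, hφ₀]
    simp
  have hone : star A.one = A.one := congrFun (congrFun (A.pos_star 1 _ A.one_mem) 0) 0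
  let φ : MState A 1 :=
    { toFun := fun x => mat1 (φ₀ x)
      map_add' := fun x y => by ext; simp
      map_smul' := fun c x => by ext; simp }
  have hφ : ∀ x i j, φ x i j = φ₀ x := fun _ _ _ => rfl
  refine ⟨φ, ⟨?_, fun r v hv => ?_⟩, fun u => hsa u⟩
  · ext i j
    rw [hφ, Subsingleton.elim i j, Matrix.one_apply_eq]
    have := hsa ⟨A.one, hone⟩
    rw [h1 _ rfl] at this
    simpa using this
  · refine Matrix.PosSemidef.of_dotProduct_mulVec_nonneg ?_ fun c => ?_
    · ext p q
      have := congrFun (congrFun (A.pos_star r _ hv) p.1) q.1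
      rw [Matrix.conjTranspose_apply] at this
      simp [mpair, hφ, ← hstar, this]
    · have h := A.pos_congr r 1 (Matrix.of fun i _ => c (i, 0)) v hv
      have hs := congrFun (congrFun (A.pos_star 1 _ h) 0) 0
      simp only [Matrix.conjTranspose_apply, Matrix.of_apply] at hs
      have h' := hsa ⟨_, hs⟩
      have h'' := hg ⟨_, hs⟩ h
      have : star c ⬝ᵥ (mpair φ v).mulVec c =
          φ₀ (∑ k, ∑ l, (star (c (k, 0)) * c (l, 0)) • v k l) := by
        simp [dotProduct, Matrix.mulVec, mpair, hφ, Fintype.sum_prod_type, Finset.mul_sum]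
        refine Finset.sum_congr rfl fun _ _ => Finset.sum_congr rfl fun _ _ => by ring
      rw [this, h']
      exact_mod_cast h''

/-- A self-adjoint element that is not positive is sent to a nonpositive number by some state. -/
theorem exists_state {y : A.carrier} (hA : A.one ≠ 0) (hy : star y = y)
    (hpos : mat1 y ∉ A.pos 1) :
    ∃ φ ∈ CS A 1, (φ y 0 0).re ≤ 0 := by
  have hone : star A.one = A.one := congrFun (congrFun (A.pos_star 1 _ A.one_mem) 0) 0
  let e : selfAdjoint A.carrier := ⟨A.one, hone⟩
  have he : e ≠ 0 := fun h => hA (congrArg Subtype.val h)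
  let s : PointedCone ℝ (selfAdjoint A.carrier) :=
    { carrier := {u | ∃ β : ℝ, 0 ≤ β ∧ mat1 ((u : A.carrier) + β • y) ∈ A.pos 1}
      add_mem' := by
        rintro u v ⟨β, hβ, h⟩ ⟨γ, hγ, h'⟩
        refine ⟨β + γ, by positivity, ?_⟩
        convert A.pos_add _ _ h _ h' using 1
        ext i j
        simp
        module
      zero_mem' := ⟨0, le_rfl, by
        convert A.pos_smul 1 0 le_rfl _ A.one_mem using 1
        ext i j
        simp⟩
      smul_mem' := by
        rintro ⟨c, hc⟩ u ⟨β, hβ, h⟩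
        refine ⟨c * β, by positivity, ?_⟩
        convert A.pos_smul _ c hc _ h using 1
        ext i j
        simp [mul_smul] }
  obtain ⟨g, hg1, hg2⟩ := riesz_extension s (LinearPMap.mkSpanSingleton e (1 : ℝ) he) (by
    rintro ⟨x, hx⟩ ⟨β, hβ, h⟩
    obtain ⟨α, rfl⟩ := Submodule.mem_span_singleton.mp hx
    rw [LinearPMap.mkSpanSingleton'_apply]
    by_contra! hα
    simp only [RingHom.id_apply, smul_eq_mul, mul_one] at hα
    rcases hβ.eq_or_lt with rfl | hβ
    · refine hA (congrFun (congrFun (A.proper _ A.one_mem ?_) 0) 0)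
      convert A.pos_smul 1 (-α)⁻¹ (by simpa using hα.le) _ h using 1
      ext i j
      simp only [Matrix.neg_apply, Matrix.smul_apply, Matrix.of_apply, zero_smul, add_zero]
      change -A.one = (((-α)⁻¹ : ℝ) : ℂ) • (α • A.one)
      rw [Complex.coe_smul, smul_smul, inv_neg, neg_mul, inv_mul_cancel₀ hα.ne, neg_smul, one_smul]
    · refine hpos ?_
      convert A.pos_smul 1 β⁻¹ (by positivity) _
        (A.pos_add _ _ h _ (A.pos_smul 1 (-α) (by linarith) _ A.one_mem)) using 1
      ext i j
      simp only [Matrix.add_apply, Matrix.smul_apply, Matrix.of_apply]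
      change y = ((β⁻¹ : ℝ) : ℂ) • (α • A.one + β • y + ((-α : ℝ) : ℂ) • A.one)
      rw [Complex.coe_smul, Complex.coe_smul, neg_smul, add_neg_cancel_comm, smul_smul,
        inv_mul_cancel₀ hβ.ne', one_smul]) (by
    intro u
    obtain ⟨t, ht, h⟩ := A.orderUnit (-u : A.carrier) (by simp)
    refine ⟨⟨t • e, Submodule.smul_mem _ _ (Submodule.mem_span_singleton_self e)⟩, 0, le_rfl, ?_⟩
    simpa [e] using h)
  obtain ⟨φ, hφ, h⟩ := exists_state_of_functional g
    (fun u hu => hg2 u ⟨0, le_rfl, by simpa using hu⟩) (by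
      rintro ⟨u, hu⟩ rfl
      exact (hg1 ⟨e, Submodule.mem_span_singleton_self e⟩).trans
        (LinearPMap.mkSpanSingleton_apply ℝ ℝ he 1))
  refine ⟨φ, hφ, ?_⟩
  have h2 := hg2 (-⟨y, hy⟩) ⟨1, zero_le_one, by
    convert A.pos_smul 1 0 le_rfl _ A.one_mem using 1
    ext i j
    simp⟩
  rw [map_neg] at h2
  have h3 := h ⟨y, hy⟩
  simp only at h3
  rw [h3, Complex.ofReal_re]
  linarith

theorem exists_mem_CS (hA : A.one ≠ 0) : ∃ φ, φ ∈ CS A 1 := by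
  have hone : star A.one = A.one := congrFun (congrFun (A.pos_star 1 _ A.one_mem) 0) 0
  obtain ⟨φ, hφ, -⟩ := exists_state (y := -A.one) hA (by simp [hone]) fun h =>
    hA (congrFun (congrFun (A.proper _ A.one_mem h) 0) 0)
  exact ⟨φ, hφ⟩

theorem bd_of_state_le_of_selfAdjoint (hA : A.one ≠ 0) {p : A.carrier} (hp : star p = p)
    {t s : ℝ} (hts : t < s) (h : ∀ φ ∈ CS A 1, |(φ p 0 0).re| ≤ t) : A.Bd (mat1 p) s := by
  have hone : star A.one = A.one := congrFun (congrFun (A.pos_star 1 _ A.one_mem) 0) 0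
  refine bd_of_pos hp ?_ ?_ <;> by_contra hn
  · obtain ⟨φ, hφ, hle⟩ := exists_state hA (by simp [hone, hp]) hn
    have := abs_le.mp (h φ hφ)
    simp [hφ.1] at hle
    linarith
  · obtain ⟨φ, hφ, hle⟩ := exists_state hA (by simp [hone, hp]) hn
    have := abs_le.mp (h φ hφ)
    simp [hφ.1] at hle
    linarith

theorem state_star {φ : MState A 1} (hφ : φ ∈ CS A 1) (x : A.carrier) :
    φ (star x) 0 0 = star (φ x 0 0) := by
  have key : ∀ p : A.carrier, star p = p → star (φ p 0 0) = φ p 0 0 := by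
    intro p hp
    obtain ⟨t, -, h⟩ := A.orderUnit p hp
    have h1 := (hφ.2 _ _ h).isHermitian.apply (0, 0) (0, 0)
    simpa [mpair, hφ.1] using h1
  have h1 := key _ (realPart x).2.star_eq
  have h2 := key _ (imaginaryPart x).2.star_eq
  conv_lhs => rw [← realPart_add_I_smul_imaginaryPart x]
  conv_rhs => rw [← realPart_add_I_smul_imaginaryPart x]
  rw [star_add, star_smul, (realPart x).2.star_eq, (imaginaryPart x).2.star_eq]
  simp only [map_add, map_smul, Matrix.add_apply, Matrix.smul_apply, star_add, star_smul, h1, h2]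

/-- The states determine the matrix norm on `V` up to a constant. -/
theorem bd_of_state_le (hA : A.one ≠ 0) {x : A.carrier} {t s : ℝ} (hts : t < s)
    (h : ∀ φ ∈ CS A 1, ‖φ x 0 0‖ ≤ t) : A.Bd (mat1 x) (s + s) := by
  have key : ∀ φ ∈ CS A 1, φ x 0 0 = (φ (realPart x : A.carrier) 0 0).re +
      Complex.I * (φ (imaginaryPart x : A.carrier) 0 0).re := by
    intro φ hφ
    have h1 := state_star hφ (realPart x : A.carrier)
    have h2 := state_star hφ (imaginaryPart x : A.carrier)
    rw [(realPart x).2.star_eq] at h1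
    rw [(imaginaryPart x).2.star_eq] at h2
    conv_lhs => rw [← realPart_add_I_smul_imaginaryPart x]
    rw [Complex.conj_eq_iff_re.mp h1.symm, Complex.conj_eq_iff_re.mp h2.symm]
    simp
  refine bd_of_parts (bd_of_state_le_of_selfAdjoint hA (realPart x).2.star_eq hts fun φ hφ => ?_)
    (bd_of_state_le_of_selfAdjoint hA (imaginaryPart x).2.star_eq hts fun φ hφ => ?_)
  · refine le_trans ?_ (h φ hφ)
    rw [key φ hφ]
    simpa using Complex.abs_re_le_norm ((φ (realPart x : A.carrier) 0 0).re +
      Complex.I * (φ (imaginaryPart x : A.carrier) 0 0).re)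
  · refine le_trans ?_ (h φ hφ)
    rw [key φ hφ]
    simpa using Complex.abs_im_le_norm ((φ (realPart x : A.carrier) 0 0).re +
      Complex.I * (φ (imaginaryPart x : A.carrier) 0 0).re)

end MOUS

/-! ### The operator norm of a scalar matrix -/

section ScalarOpNorm

variable {m n : Type*} [Fintype m] [Fintype n] [DecidableEq n]

theorem scalarOpNorm_nonneg (M : Matrix m n ℂ) : 0 ≤ scalarOpNorm M := norm_nonneg _

theorem norm_toEuclideanLin_le (M : Matrix m n ℂ) (x : EuclideanSpace ℂ n) :
    ‖Matrix.toEuclideanLin M x‖ ≤ scalarOpNorm M * ‖x‖ :=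
  (LinearMap.toContinuousLinearMap (Matrix.toEuclideanLin M)).le_opNorm x

theorem scalarOpNorm_le {M : Matrix m n ℂ} {C : ℝ} (hC : 0 ≤ C)
    (h : ∀ x, ‖Matrix.toEuclideanLin M x‖ ≤ C * ‖x‖) : scalarOpNorm M ≤ C :=
  ContinuousLinearMap.opNorm_le_bound _ hC h

theorem norm_entry_le_scalarOpNorm (M : Matrix m n ℂ) (i : m) (j : n) :
    ‖M i j‖ ≤ scalarOpNorm M := by
  have h := norm_toEuclideanLin_le M (EuclideanSpace.single j 1)
  rw [PiLp.norm_single, norm_one, mul_one] at h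
  refine le_trans ?_ ((PiLp.norm_apply_le _ i).trans h)
  simp [Matrix.toLpLin_apply]

theorem scalarOpNorm_le_of_inner {M : Matrix m n ℂ} {C : ℝ} (hC : 0 ≤ C)
    (h : ∀ η ξ, ‖inner ℂ η (Matrix.toEuclideanLin M ξ)‖ ≤ C * ‖η‖ * ‖ξ‖) :
    scalarOpNorm M ≤ C := by
  refine scalarOpNorm_le hC fun ξ => ?_
  have := h (Matrix.toEuclideanLin M ξ) ξ
  rw [inner_self_eq_norm_sq_to_K] at this
  simp only [norm_pow, Complex.coe_algebraMap, Complex.norm_real, norm_norm] at this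
  rcases (norm_nonneg (Matrix.toEuclideanLin M ξ)).eq_or_lt with h0 | h0
  · rw [← h0]; positivity
  · nlinarith

theorem scalarOpNorm_col_le (c : EuclideanSpace ℂ m) :
    scalarOpNorm (Matrix.of fun i (_ : Fin 1) => c i) ≤ ‖c‖ := by
  refine scalarOpNorm_le (norm_nonneg _) fun x => le_of_eq ?_
  have : Matrix.toEuclideanLin (Matrix.of fun i (_ : Fin 1) => c i) x = x 0 • c := by
    ext i
    simp [Matrix.toLpLin_apply, Matrix.mulVec, dotProduct, mul_comm]
  rw [this, norm_smul, mul_comm, EuclideanSpace.norm_eq x]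
  simp

theorem scalarOpNorm_conjTranspose [DecidableEq m] (M : Matrix m n ℂ) :
    scalarOpNorm M.conjTranspose = scalarOpNorm M :=
  Matrix.l2_opNorm_conjTranspose M

theorem scalarOpNorm_row_le [DecidableEq m] (c : EuclideanSpace ℂ m) :
    scalarOpNorm (Matrix.of fun (_ : Fin 1) i => star (c i)) ≤ ‖c‖ :=
  (scalarOpNorm_conjTranspose (Matrix.of fun i (_ : Fin 1) => c i)).trans_le
    (scalarOpNorm_col_le c)

end ScalarOpNorm

/-! ### The matrix metrics -/

section Metric

variable {A : MOUS} {L : ∀ n : ℕ, Matrix (Fin n) (Fin n) A.carrier → ℝ}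

/-- The set whose supremum is `Dmet A L n φ ψ`. -/
def dSet (A : MOUS) (L : ∀ n : ℕ, Matrix (Fin n) (Fin n) A.carrier → ℝ) (n : ℕ)
    (φ ψ : MState A n) : Set ℝ :=
  {x | ∃ (r : ℕ) (a : Matrix (Fin r) (Fin r) A.carrier), L r a ≤ 1 ∧
    x = scalarOpNorm (mpair φ a - mpair ψ a)}

theorem EuclideanSpace.norm_slice_le {ι κ : Type*} [Fintype ι] [Fintype κ]
    (η : EuclideanSpace ℂ (ι × κ)) (k : κ) :
    ‖(WithLp.toLp 2 fun i => η (i, k) : EuclideanSpace ℂ ι)‖ ≤ ‖η‖ := by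
  rw [EuclideanSpace.norm_eq, EuclideanSpace.norm_eq]
  refine Real.sqrt_le_sqrt ?_
  rw [Fintype.sum_prod_type]
  exact Finset.sum_le_sum fun i _ =>
    Finset.single_le_sum (f := fun k => ‖η (i, k)‖ ^ 2) (fun _ _ => by positivity)
      (Finset.mem_univ k)

theorem le_of_mem_dSet (hL : IsMatrixLipschitzSeminorm A L) {n : ℕ} {φ ψ : MState A n} {C : ℝ}
    (hC : 0 ≤ C) (h : ∀ x k l, ‖φ x k l - ψ x k l‖ ≤ C * L 1 (mat1 x)) {y : ℝ}
    (hy : y ∈ dSet A L n φ ψ) : y ≤ n ^ 2 * C := by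
  obtain ⟨r, a, ha, rfl⟩ := hy
  refine scalarOpNorm_le_of_inner (by positivity) fun η ξ => ?_
  let α : Fin n → Matrix (Fin 1) (Fin r) ℂ := fun k => Matrix.of fun _ i => star (η (i, k))
  let β : Fin n → Matrix (Fin r) (Fin 1) ℂ := fun l => Matrix.of fun j _ => ξ (j, l)
  let x : Fin n → Fin n → A.carrier := fun k l => mmulMat (α k) a (β l) 0 0
  have hx : ∀ k l, L 1 (mat1 (x k l)) ≤ ‖η‖ * ‖ξ‖ := by
    intro k l
    have e : mat1 (x k l) = mmulMat (α k) a (β l) := by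
      ext i j
      rw [Subsingleton.elim i 0, Subsingleton.elim j 0]
      rfl
    rw [e]
    have h1 : scalarOpNorm (α k) ≤ ‖η‖ :=
      (scalarOpNorm_row_le (WithLp.toLp 2 fun i => η (i, k))).trans
        (EuclideanSpace.norm_slice_le η k)
    have h2 : scalarOpNorm (β l) ≤ ‖ξ‖ :=
      (scalarOpNorm_col_le (WithLp.toLp 2 fun i => ξ (i, l))).trans
        (EuclideanSpace.norm_slice_le ξ l)
    calc _ ≤ _ := hL.mmul_le _ _ _ _ _
      _ ≤ ‖η‖ * 1 * ‖ξ‖ := mul_le_mul (mul_le_mul h1 ha (hL.nonneg _ _) (norm_nonneg _)) h2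
        (scalarOpNorm_nonneg _) (by positivity)
      _ = _ := by ring
  have key : inner ℂ η (Matrix.toEuclideanLin (mpair φ a - mpair ψ a) ξ) =
      ∑ k, ∑ l, (φ (x k l) k l - ψ (x k l) k l) := by
    simp only [PiLp.inner_apply, Matrix.toLpLin_apply, Matrix.mulVec, dotProduct,
      Fintype.sum_prod_type, mpair, x, mmulMat, α, β, Matrix.of_apply, map_sum, map_smul,
      Matrix.sum_apply, Matrix.smul_apply, smul_eq_mul, Matrix.sub_apply, RCLike.inner_apply,
      ← Finset.sum_sub_distrib, Finset.sum_mul]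
    rw [Finset.sum_comm]
    refine Finset.sum_congr rfl fun k _ => ?_
    conv_rhs => rw [Finset.sum_comm]
    refine Finset.sum_congr rfl fun i _ => ?_
    conv_rhs => rw [Finset.sum_comm]
    refine Finset.sum_congr rfl fun j _ => Finset.sum_congr rfl fun l _ => ?_
    simp only [RCLike.star_def]
    ring
  rw [key]
  calc _ ≤ ∑ k : Fin n, ∑ l : Fin n, C * (‖η‖ * ‖ξ‖) :=
        norm_sum_le_of_le _ fun k _ => norm_sum_le_of_le _ fun l _ =>
          (h _ k l).trans (mul_le_mul_of_nonneg_left (hx k l) hC)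
    _ = _ := by simp; ring

theorem Dmet_le (hL : IsMatrixLipschitzSeminorm A L) {n : ℕ} {φ ψ : MState A n} {C : ℝ}
    (hC : 0 ≤ C) (h : ∀ x k l, ‖φ x k l - ψ x k l‖ ≤ C * L 1 (mat1 x)) :
    Dmet A L n φ ψ ≤ n ^ 2 * C :=
  Real.sSup_le (fun _ => le_of_mem_dSet hL hC h) (by positivity)

theorem bddAbove_dSet (hL : IsMatrixLipschitzSeminorm A L) {n : ℕ} {φ ψ : MState A n} {C : ℝ}
    (hC : 0 ≤ C) (h : ∀ x k l, ‖φ x k l - ψ x k l‖ ≤ C * L 1 (mat1 x)) :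
    BddAbove (dSet A L n φ ψ) :=
  ⟨_, fun _ => le_of_mem_dSet hL hC h⟩

theorem exists_mem_dSet {n : ℕ} (φ ψ : MState A n) {x : A.carrier} (hx : L 1 (mat1 x) ≤ 1)
    (k l : Fin n) : ∃ y ∈ dSet A L n φ ψ, ‖φ x k l - ψ x k l‖ ≤ y :=
  ⟨_, ⟨1, mat1 x, hx, rfl⟩,
    norm_entry_le_scalarOpNorm (mpair φ (mat1 x) - mpair ψ (mat1 x)) (0, k) (0, l)⟩

theorem norm_sub_le_Dmet {n : ℕ} {φ ψ : MState A n} (hb : BddAbove (dSet A L n φ ψ))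
    {x : A.carrier} (hx : L 1 (mat1 x) ≤ 1) (k l : Fin n) :
    ‖φ x k l - ψ x k l‖ ≤ Dmet A L n φ ψ := by
  obtain ⟨y, hy, h⟩ := exists_mem_dSet φ ψ hx k l
  exact h.trans (le_csSup hb hy)

theorem mat1_smul (c : ℂ) (x : A.carrier) : mat1 (c • x) = c • mat1 x := rfl

/-- A bound on the Lipschitz ball extends by homogeneity to all of `V`. -/
theorem norm_sub_le_mul (hL : IsMatrixLipschitzSeminorm A L) {n : ℕ} {φ ψ : MState A n}
    (hφ : φ ∈ CS A n) (hψ : ψ ∈ CS A n) {C : ℝ}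
    (h : ∀ x, L 1 (mat1 x) ≤ 1 → ∀ k l, ‖φ x k l - ψ x k l‖ ≤ C) (x : A.carrier)
    (k l : Fin n) : ‖φ x k l - ψ x k l‖ ≤ C * L 1 (mat1 x) := by
  rcases (hL.nonneg 1 (mat1 x)).eq_or_lt with h0 | h0
  · obtain ⟨lam, hlam⟩ := (hL.null_iff 1 _).mp h0.symm
    have hx : x = lam 0 0 • A.one := congrFun (congrFun hlam 0) 0
    rw [← h0, mul_zero, hx, map_smul, map_smul, hφ.1, hψ.1, sub_self, norm_zero]
  · set s := L 1 (mat1 x) with hs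
    have h1 := h (((s⁻¹ : ℝ) : ℂ) • x) (by
      rw [mat1_smul, hL.smul_eq, ← hs, Complex.norm_real, Real.norm_of_nonneg (by positivity),
        inv_mul_cancel₀ h0.ne']) k l
    rw [map_smul, map_smul, Matrix.smul_apply, Matrix.smul_apply, ← smul_sub, norm_smul,
      Complex.norm_real, Real.norm_of_nonneg (by positivity)] at h1
    rwa [inv_mul_le_iff₀ h0, mul_comm] at h1

end Metric

/-! ### The state space of a quantized metric space -/

section LipNorm

variable {A : MOUS} {L : ∀ n : ℕ, Matrix (Fin n) (Fin n) A.carrier → ℝ}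

theorem continuous_BW_eval (n : ℕ) (x : A.carrier) (k l : Fin n) :
    @Continuous _ _ (BWtop A n) _ fun φ : {φ : MState A n // φ ∈ CS A n} => φ.1 x k l := by
  let _ := lmTop A n
  let _ := BWtop A n
  have h1 : Continuous fun φ : {φ : MState A n // φ ∈ CS A n} => φ.1 := continuous_induced_dom
  have h2 : Continuous fun φ : MState A n => (φ : A.carrier → Matrix (Fin n) (Fin n) ℂ) :=
    continuous_induced_dom
  exact ((continuous_apply x).comp (h2.comp h1)).matrix_elem k l

theorem isClosed_range_CS (A : MOUS) (n : ℕ) :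
    IsClosed {f : A.carrier → Matrix (Fin n) (Fin n) ℂ | ∃ φ ∈ CS A n, ⇑φ = f} := by
  have h : {f : A.carrier → Matrix (Fin n) (Fin n) ℂ | ∃ φ ∈ CS A n, ⇑φ = f} =
      {f | (∀ x y, f (x + y) = f x + f y) ∧ (∀ (c : ℂ) x, f (c • x) = c • f x) ∧ f A.one = 1 ∧
        ∀ r, ∀ v ∈ A.pos r, (∀ p q : Fin r × Fin n,
            star (f (v q.1 p.1) q.2 p.2) = f (v p.1 q.1) p.2 q.2) ∧
          ∀ c, 0 ≤ star c ⬝ᵥ (Matrix.of fun p q : Fin r × Fin n =>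
            f (v p.1 q.1) p.2 q.2).mulVec c} := by
    ext f
    constructor
    · rintro ⟨φ, hφ, rfl⟩
      refine ⟨map_add φ, map_smul φ, hφ.1, fun r v hv => ?_⟩
      have := Matrix.posSemidef_iff_dotProduct_mulVec.mp (hφ.2 r v hv)
      exact ⟨fun p q => this.1.apply p q, this.2⟩
    · rintro ⟨h1, h2, h3, h4⟩
      refine ⟨⟨⟨f, h1⟩, h2⟩, ⟨h3, fun r v hv => ?_⟩, rfl⟩
      exact Matrix.posSemidef_iff_dotProduct_mulVec.mpr
        ⟨Matrix.IsHermitian.ext (h4 r v hv).1, (h4 r v hv).2⟩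
  rw [h]
  simp only [Set.ofPred_and, Set.ofPred_forall, dotProduct, Matrix.mulVec, Matrix.of_apply]
  have hc : ∀ (x : A.carrier) (k l : Fin n), Continuous
      fun f : A.carrier → Matrix (Fin n) (Fin n) ℂ => f x k l :=
    fun x k l => (continuous_apply x).matrix_elem k l
  refine .inter (isClosed_iInter fun x => isClosed_iInter fun y => isClosed_eq ?_ ?_)
    (.inter (isClosed_iInter fun c => isClosed_iInter fun x => isClosed_eq ?_ ?_)
    (.inter (isClosed_eq ?_ ?_) (isClosed_iInter fun r => isClosed_iInter fun v =>
      isClosed_iInter fun _ => .inter (isClosed_iInter fun p => isClosed_iInter fun q =>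
        isClosed_eq ?_ ?_) (isClosed_iInter fun c => isClosed_le ?_ ?_)))) <;> fun_prop

theorem compactSpace_BW (A : MOUS) (n : ℕ) : @CompactSpace _ (BWtop A n) := by
  let _ := BWtop A n
  choose t ht hbd using fun x : A.carrier => MOUS.exists_bd_mat1 x
  have hind : Topology.IsInducing fun φ : {φ : MState A n // φ ∈ CS A n} =>
      (φ.1 : A.carrier → Matrix (Fin n) (Fin n) ℂ) := ⟨induced_compose⟩
  refine ⟨hind.isCompact_iff.mpr ?_⟩
  have hK : IsCompact (Set.univ.pi fun x : A.carrier => (Set.univ.pi fun _ => Set.univ.pi fun _ =>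
      Metric.closedBall 0 (t x) : Set (Matrix (Fin n) (Fin n) ℂ))) :=
    isCompact_univ_pi fun x => isCompact_univ_pi fun _ => isCompact_univ_pi fun _ =>
      isCompact_closedBall _ _
  have hrange : (fun φ : {φ : MState A n // φ ∈ CS A n} =>
      (φ.1 : A.carrier → Matrix (Fin n) (Fin n) ℂ)) '' Set.univ =
        {f | ∃ φ ∈ CS A n, ⇑φ = f} := by
    ext f
    simp
  rw [hrange]
  refine hK.of_isClosed_subset (isClosed_range_CS A n) ?_
  rintro _ ⟨φ, hφ, rfl⟩ x - k - l -
  simpa using (hbd x).norm_state_le hφ k l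

theorem convex_mem_CS {n : ℕ} {φ ψ : MState A n} (hφ : φ ∈ CS A n) (hψ : ψ ∈ CS A n)
    (t : unitInterval) : ((1 - t : ℝ) : ℂ) • φ + ((t : ℝ) : ℂ) • ψ ∈ CS A n := by
  refine ⟨?_, fun r v hv => ?_⟩
  · rw [LinearMap.add_apply, LinearMap.smul_apply, LinearMap.smul_apply, hφ.1, hψ.1, ← add_smul]
    simp
  · have h := ((hφ.2 r v hv).smul (a := ((1 - t : ℝ) : ℂ))
      (by exact_mod_cast unitInterval.one_minus_nonneg t)).add
      ((hψ.2 r v hv).smul (a := ((t : ℝ) : ℂ)) (by exact_mod_cast t.2.1))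
    convert h using 1
    ext p q
    simp [mpair]

theorem bddAbove_dSet_trans {n : ℕ} {φ ψ χ : MState A n} (h1 : BddAbove (dSet A L n χ φ))
    (h2 : BddAbove (dSet A L n χ ψ)) : BddAbove (dSet A L n φ ψ) := by
  obtain ⟨C, hC⟩ := h1
  obtain ⟨D, hD⟩ := h2
  refine ⟨C + D, ?_⟩
  rintro _ ⟨r, a, ha, rfl⟩
  have e1 := hC ⟨r, a, ha, rfl⟩
  have e2 := hD ⟨r, a, ha, rfl⟩
  have e : mpair φ a - mpair ψ a = (mpair χ a - mpair ψ a) - (mpair χ a - mpair φ a) := by abel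
  have h3 : scalarOpNorm (mpair φ a - mpair ψ a) ≤
      scalarOpNorm (mpair χ a - mpair ψ a) + scalarOpNorm (mpair χ a - mpair φ a) := by
    rw [e]
    unfold scalarOpNorm
    rw [map_sub, map_sub]
    exact norm_sub_le _ _
  linarith

/-- The matrix metric of a matrix Lip-norm is finite on states. -/
theorem IsMatrixLipNorm.bddAbove_dSet (hL : IsMatrixLipNorm A L) {φ ψ : MState A 1}
    (hφ : φ ∈ CS A 1) (hψ : ψ ∈ CS A 1) : BddAbove (dSet A L 1 φ ψ) := by
  by_contra hb
  let χ : unitInterval → {φ : MState A 1 // φ ∈ CS A 1} := fun t =>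
    ⟨_, convex_mem_CS hφ hψ t⟩
  have hχ : ∀ s t, BddAbove (dSet A L 1 (χ s).1 (χ t).1) → s = t := by
    rintro s t ⟨C, hC⟩
    by_contra hst
    have hd : 0 < |(t : ℝ) - s| := abs_pos.mpr (sub_ne_zero.mpr fun h => hst (Subtype.ext h.symm))
    refine hb ⟨|(t : ℝ) - s|⁻¹ * C, ?_⟩
    rintro _ ⟨r, a, ha, rfl⟩
    have h := hC ⟨r, a, ha, rfl⟩
    have e : mpair (χ s).1 a - mpair (χ t).1 a =
        (((t : ℝ) - s : ℝ) : ℂ) • (mpair φ a - mpair ψ a) := by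
      ext p q
      simp [χ, mpair]
      ring
    rw [e] at h
    unfold scalarOpNorm at h ⊢
    rw [map_smul, map_smul, norm_smul, Complex.norm_real, Real.norm_eq_abs] at h
    rwa [le_inv_mul_iff₀ hd]
  have key : ∀ U, @IsOpen _ (Dtop A L 1) U → ∀ t₀, χ t₀ ∈ U → {t | χ t ∉ U}.Finite := by
    intro U hU
    induction hU with
    | basic U h =>
      obtain ⟨φ₀, ε, hε, rfl⟩ := h
      refine fun _ _ => Set.Subsingleton.finite fun s hs t ht => ?_
      have hbd : ∀ s, χ s ∉ {ψ | Dmet A L 1 φ₀.1 ψ.1 < ε} →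
          BddAbove (dSet A L 1 φ₀.1 (χ s).1) := by
        intro s hs
        by_contra h
        exact hs ((Real.sSup_of_not_bddAbove h).trans_lt hε)
      exact hχ s t (bddAbove_dSet_trans (hbd s hs) (hbd t ht))
    | univ => simp
    | inter U V _ _ hU hV =>
      intro t₀ ht₀
      refine ((hU t₀ ht₀.1).union (hV t₀ ht₀.2)).subset fun t ht => ?_
      by_contra h
      simp only [Set.mem_union, Set.mem_ofPred_eq, not_or, not_not] at h
      exact ht h
    | sUnion S _ hS =>
      rintro t₀ ⟨U, hU, ht₀⟩
      exact (hS U hU t₀ ht₀).subset fun t ht h => ht ⟨U, hU, h⟩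
  obtain ⟨x, hx⟩ : ∃ x, φ x 0 0 ≠ ψ x 0 0 := by
    by_contra! h
    exact hb (_root_.bddAbove_dSet hL.toIsMatrixLipschitzSeminorm (C := 0) le_rfl fun x k l => by
      rw [Subsingleton.elim k 0, Subsingleton.elim l 0, h, sub_self, norm_zero, zero_mul])
  have hd : 0 < ‖ψ x 0 0 - φ x 0 0‖ := norm_pos_iff.mpr (sub_ne_zero.mpr hx.symm)
  have hcalc : ∀ t, (χ t).1 x 0 0 - φ x 0 0 = (t : ℝ) * (ψ x 0 0 - φ x 0 0) := by
    intro t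
    simp [χ]
    ring
  have hopen : @IsOpen _ (BWtop A 1)
      {χ | ‖χ.1 x 0 0 - φ x 0 0‖ < ‖ψ x 0 0 - φ x 0 0‖ / 2} := by
    let _ := BWtop A 1
    exact isOpen_lt (((continuous_BW_eval 1 x 0 0).sub continuous_const).norm) continuous_const
  rw [← hL.top_eq] at hopen
  refine (Set.Icc_infinite (α := unitInterval) (a := ⟨1 / 2, by norm_num, by norm_num⟩)
    (b := 1) ?_) ((key _ hopen 0 ?_).subset ?_)
  · rw [← Subtype.coe_lt_coe]
    norm_num
  · simp [hcalc]
    exact sub_ne_zero.mpr hx.symm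
  · rintro t ⟨ht, -⟩
    have ht' : (1 / 2 : ℝ) ≤ t := ht
    simp only [Set.mem_ofPred_eq, hcalc, norm_mul, Complex.norm_real, Real.norm_eq_abs, not_lt,
      abs_of_nonneg t.2.1]
    nlinarith

theorem Dmet_self (hL : IsMatrixLipschitzSeminorm A L) {n : ℕ} (φ : MState A n) :
    Dmet A L n φ φ ≤ 0 := by
  simpa using Dmet_le hL (φ := φ) (ψ := φ) le_rfl fun x k l => by simp

/-- Modulo scalars, the Lipschitz ball is totally bounded. -/
def HasLipNets (A : MOUS) (L : ∀ n : ℕ, Matrix (Fin n) (Fin n) A.carrier → ℝ) : Prop :=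
  ∀ ε : ℝ, 0 < ε → ∃ F : Set A.carrier, F.Finite ∧ ∀ a, L 1 (mat1 a) ≤ 1 →
    ∃ f ∈ F, ∃ c : ℂ, A.Bd (mat1 (a - f - c • A.one)) ε

theorem IsMatrixLipNorm.hasLipNets (hL : IsMatrixLipNorm A L) (hA : A.one ≠ 0) :
    HasLipNets A L := by
  intro ε hε
  obtain ⟨φ₀, hφ₀⟩ := MOUS.exists_mem_CS hA
  let _ := BWtop A 1
  have := compactSpace_BW A 1
  let X := {φ : MState A 1 // φ ∈ CS A 1}
  obtain ⟨T, hT⟩ := CompactSpace.elim_nhds_subcover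
    (fun φ : X => {ψ : X | Dmet A L 1 φ.1 ψ.1 < ε / 8}) fun φ => by
      refine IsOpen.mem_nhds ?_
        ((Dmet_self hL.toIsMatrixLipschitzSeminorm φ.1).trans_lt (by positivity))
      change @IsOpen _ (BWtop A 1) _
      rw [← hL.top_eq]
      exact .basic _ ⟨φ, ε / 8, by positivity, rfl⟩
  let S : Set A.carrier := {a | L 1 (mat1 a) ≤ 1}
  let Φ : A.carrier → T → ℂ := fun a φ => φ.1.1 a 0 0 - φ₀ a 0 0
  have hS : TotallyBounded (Φ '' S) := by
    refine TotallyBounded.subset ?_ (isCompact_univ_pi fun φ : T =>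
      isCompact_closedBall (0 : ℂ) (Dmet A L 1 φ.1.1 φ₀)).totallyBounded
    rintro _ ⟨a, ha, rfl⟩ φ -
    rw [mem_closedBall_zero_iff]
    exact norm_sub_le_Dmet (hL.bddAbove_dSet φ.1.2 hφ₀) ha 0 0
  obtain ⟨F, hFS, hF, hcov⟩ := Metric.finite_approx_of_totallyBounded hS (ε / 8) (by positivity)
  refine ⟨Function.invFunOn Φ S '' F, hF.image _, fun a ha => ?_⟩
  obtain ⟨y, hy, hay⟩ := Set.mem_iUnion₂.mp (hcov ⟨a, ha, rfl⟩)
  set f := Function.invFunOn Φ S y with hf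
  have hfS : L 1 (mat1 f) ≤ 1 := Function.invFunOn_mem (hFS hy)
  have hfy : Φ f = y := Function.invFunOn_eq (hFS hy)
  refine ⟨f, ⟨y, hy, rfl⟩, φ₀ (a - f) 0 0, ?_⟩
  refine (MOUS.bd_of_state_le hA (t := 3 * (ε / 8)) (s := ε / 2) (by linarith)
    fun ψ hψ => ?_).mono (by linarith)
  obtain ⟨φ, hφ, hd⟩ : ∃ φ ∈ T, Dmet A L 1 φ.1 ψ < ε / 8 := by
    have := hT.ge (Set.mem_univ (⟨ψ, hψ⟩ : X))
    obtain ⟨φ, hφ, h⟩ := Set.mem_iUnion₂.mp this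
    exact ⟨φ, hφ, h⟩
  have hb := hL.bddAbove_dSet φ.2 hψ
  have h1 := norm_sub_le_Dmet hb ha 0 0
  have h2 := norm_sub_le_Dmet hb hfS 0 0
  have h3 : ‖Φ a ⟨φ, hφ⟩ - Φ f ⟨φ, hφ⟩‖ < ε / 8 := by
    rw [Metric.mem_ball, ← hfy] at hay
    rw [← dist_eq_norm]
    exact (dist_le_pi_dist _ _ _).trans_lt hay
  have e : ψ (a - f - φ₀ (a - f) 0 0 • A.one) 0 0 =
      (Φ a ⟨φ, hφ⟩ - Φ f ⟨φ, hφ⟩) - (φ.1 a 0 0 - ψ a 0 0) + (φ.1 f 0 0 - ψ f 0 0) := by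
    simp [Φ, hψ.1]
    ring
  rw [e]
  refine (norm_add_le _ _).trans ?_
  linarith [norm_sub_le (Φ a ⟨φ, hφ⟩ - Φ f ⟨φ, hφ⟩) (φ.1 a 0 0 - ψ a 0 0)]

end LipNorm

/-! ### Matrix Lip-norms from total boundedness -/

section HasLipNets

variable {A : MOUS} {L : ∀ n : ℕ, Matrix (Fin n) (Fin n) A.carrier → ℝ}

theorem Dmet_nonneg (n : ℕ) (φ ψ : MState A n) : 0 ≤ Dmet A L n φ ψ :=
  Real.sSup_nonneg (by rintro _ ⟨_, _, _, rfl⟩; exact scalarOpNorm_nonneg _)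

theorem Dmet_triangle {n : ℕ} {φ ψ χ : MState A n} (h1 : BddAbove (dSet A L n φ ψ))
    (h2 : BddAbove (dSet A L n ψ χ)) : Dmet A L n φ χ ≤ Dmet A L n φ ψ + Dmet A L n ψ χ := by
  refine Real.sSup_le ?_ (add_nonneg (Dmet_nonneg _ _ _) (Dmet_nonneg _ _ _))
  rintro _ ⟨r, a, ha, rfl⟩
  refine le_trans ?_ (add_le_add (le_csSup h1 ⟨r, a, ha, rfl⟩) (le_csSup h2 ⟨r, a, ha, rfl⟩))
  unfold scalarOpNorm
  rw [← sub_add_sub_cancel (mpair φ a) (mpair ψ a) (mpair χ a), map_add, map_add]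
  exact norm_add_le _ _

theorem MOUS.Bd.norm_state_sub_le {a f : A.carrier} {c : ℂ} {ε : ℝ}
    (h : A.Bd (mat1 (a - f - c • A.one)) ε) {n : ℕ} {φ ψ : MState A n} (hφ : φ ∈ CS A n)
    (hψ : ψ ∈ CS A n) (k l : Fin n) :
    ‖φ a k l - ψ a k l‖ ≤ ‖φ f k l - ψ f k l‖ + 2 * ε := by
  have h1 := h.norm_state_le hφ k l
  have h2 := h.norm_state_le hψ k l
  have e : φ a k l - ψ a k l = (φ f k l - ψ f k l) +
      (φ (a - f - c • A.one) k l - ψ (a - f - c • A.one) k l) := by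
    simp [hφ.1, hψ.1]
    ring
  rw [e]
  refine (norm_add_le _ _).trans ?_
  linarith [norm_sub_le (φ (a - f - c • A.one) k l) (ψ (a - f - c • A.one) k l)]

theorem norm_sub_le_of_net (hL : IsMatrixLipschitzSeminorm A L) {F : Set A.carrier} {ε : ℝ}
    (hnet : ∀ a, L 1 (mat1 a) ≤ 1 → ∃ f ∈ F, ∃ c : ℂ, A.Bd (mat1 (a - f - c • A.one)) ε)
    {n : ℕ} {φ ψ : MState A n} (hφ : φ ∈ CS A n) (hψ : ψ ∈ CS A n) {M : ℝ}
    (hM : ∀ f ∈ F, ∀ k l, ‖φ f k l - ψ f k l‖ ≤ M) (x : A.carrier) (k l : Fin n) :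
    ‖φ x k l - ψ x k l‖ ≤ (M + 2 * ε) * L 1 (mat1 x) := by
  refine norm_sub_le_mul hL hφ hψ (fun x hx k l => ?_) x k l
  obtain ⟨f, hf, c, h⟩ := hnet x hx
  linarith [h.norm_state_sub_le hφ hψ k l, hM f hf k l]

theorem HasLipNets.bddAbove_dSet (h : HasLipNets A L) (hL : IsMatrixLipschitzSeminorm A L)
    {n : ℕ} {φ ψ : MState A n} (hφ : φ ∈ CS A n) (hψ : ψ ∈ CS A n) :
    BddAbove (dSet A L n φ ψ) := by
  obtain ⟨F, hF, hnet⟩ := h 1 one_pos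
  obtain ⟨M, hM⟩ : ∃ M : ℝ, ∀ f ∈ F, ∀ k l, ‖φ f k l - ψ f k l‖ ≤ M := by
    obtain ⟨M, hM⟩ := (hF.image fun f => ∑ k, ∑ l, ‖φ f k l - ψ f k l‖).bddAbove
    refine ⟨M, fun f hf k l => le_trans ?_ (hM ⟨f, hf, rfl⟩)⟩
    exact (Finset.single_le_sum (f := fun l => ‖φ f k l - ψ f k l‖)
      (fun _ _ => norm_nonneg _) (Finset.mem_univ l)).trans
      (Finset.single_le_sum (f := fun k => ∑ l, ‖φ f k l - ψ f k l‖)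
        (fun _ _ => by positivity) (Finset.mem_univ k))
  refine _root_.bddAbove_dSet hL (C := max M 0 + 2 * 1) (by positivity)
    (norm_sub_le_of_net hL hnet hφ hψ fun f hf k l => (hM f hf k l).trans (le_max_left _ _))

theorem HasLipNets.Dtop_le (h : HasLipNets A L) (hL : IsMatrixLipschitzSeminorm A L) (n : ℕ) :
    Dtop A L n ≤ BWtop A n := by
  let _ := Dtop A L n
  have hc : ∀ x k l, Continuous fun φ : {φ : MState A n // φ ∈ CS A n} => φ.1 x k l := by
    intro x k l
    rw [continuous_iff_continuousAt]
    intro φ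
    rw [ContinuousAt, Metric.tendsto_nhds]
    intro ε hε
    have hs : 0 < L 1 (mat1 x) + 1 := add_pos_of_nonneg_of_pos (hL.nonneg _ _) one_pos
    have hopen : IsOpen {ψ : {φ : MState A n // φ ∈ CS A n} |
        Dmet A L n φ.1 ψ.1 < ε / (L 1 (mat1 x) + 1)} := .basic _ ⟨φ, _, by positivity, rfl⟩
    filter_upwards [hopen.mem_nhds ((Dmet_self hL φ.1).trans_lt (by positivity))] with ψ hψ
    have h1 := norm_sub_le_mul hL φ.2 ψ.2
      (fun y hy => norm_sub_le_Dmet (h.bddAbove_dSet hL φ.2 ψ.2) hy) x k l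
    rw [dist_comm, dist_eq_norm]
    have h2 := (lt_div_iff₀ hs).mp hψ
    linarith [Dmet_nonneg (L := L) n φ.1 ψ.1]
  unfold BWtop lmTop
  rw [induced_compose]
  exact continuous_iff_le_induced.mp (continuous_pi fun x => continuous_matrix fun k l => hc x k l)

theorem HasLipNets.le_Dtop (h : HasLipNets A L) (hL : IsMatrixLipschitzSeminorm A L) (n : ℕ) :
    BWtop A n ≤ Dtop A L n := by
  let _ := BWtop A n
  refine le_generateFrom ?_
  rintro _ ⟨φ, ε, hε, rfl⟩
  refine isOpen_iff_mem_nhds.mpr fun ψ (hψ : Dmet A L n φ.1 ψ.1 < ε) => ?_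
  obtain ⟨η, hη, hηε⟩ : ∃ η : ℝ, 0 < η ∧ (n : ℝ) ^ 2 * (η + 2 * η) < ε - Dmet A L n φ.1 ψ.1 := by
    have hd := sub_pos.mpr hψ
    refine ⟨(ε - Dmet A L n φ.1 ψ.1) / (3 * n ^ 2 + 1), by positivity, ?_⟩
    rw [show (n : ℝ) ^ 2 * ((ε - Dmet A L n φ.1 ψ.1) / (3 * n ^ 2 + 1) +
        2 * ((ε - Dmet A L n φ.1 ψ.1) / (3 * n ^ 2 + 1))) =
        (3 * n ^ 2 * (ε - Dmet A L n φ.1 ψ.1)) / (3 * n ^ 2 + 1) by ring,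
      div_lt_iff₀ (by positivity)]
    linarith
  obtain ⟨F, hF, hnet⟩ := h η hη
  have hev : ∀ᶠ χ in nhds ψ, ∀ f ∈ F, ∀ k l, ‖ψ.1 f k l - χ.1 f k l‖ < η := by
    rw [Filter.eventually_all_finite hF]
    intro f _
    simp only [Filter.eventually_all]
    intro k l
    have := (continuous_BW_eval n f k l).tendsto ψ
    filter_upwards [Metric.tendsto_nhds.mp this η hη] with χ hχ
    rwa [← dist_eq_norm, dist_comm]
  filter_upwards [hev] with χ hχ
  have h1 : Dmet A L n ψ.1 χ.1 ≤ n ^ 2 * (η + 2 * η) := Dmet_le hL (by positivity)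
    (norm_sub_le_of_net hL hnet ψ.2 χ.2 fun f hf k l => (hχ f hf k l).le)
  have h2 := Dmet_triangle (h.bddAbove_dSet hL φ.2 ψ.2) (h.bddAbove_dSet hL ψ.2 χ.2)
  change Dmet A L n φ.1 χ.1 < ε
  linarith

theorem HasLipNets.isMatrixLipNorm (h : HasLipNets A L) (hL : IsMatrixLipschitzSeminorm A L) :
    IsMatrixLipNorm A L :=
  ⟨hL, fun n => le_antisymm (h.Dtop_le hL n) (h.le_Dtop hL n)⟩

end HasLipNets

/-! ### Matrix seminorms -/

section Seminorm

variable {A : MOUS} {N : ∀ n : ℕ, Matrix (Fin n) (Fin n) A.carrier → ℝ}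

theorem IsMatrixSeminorm.zero (hN : IsMatrixSeminorm A N) (n : ℕ) : N n 0 = 0 :=
  le_antisymm (by simpa using hN.smul_le n 0 0) (hN.nonneg n 0)

theorem IsMatrixSeminorm.smul_eq (hN : IsMatrixSeminorm A N) (n : ℕ) (c : ℂ)
    (v : Matrix (Fin n) (Fin n) A.carrier) : N n (c • v) = ‖c‖ * N n v := by
  rcases eq_or_ne c 0 with rfl | hc
  · simp [hN.zero]
  refine le_antisymm (hN.smul_le n c v) ?_
  have h := hN.smul_le n c⁻¹ (c • v)
  rw [smul_smul, inv_mul_cancel₀ hc, one_smul, norm_inv] at h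
  exact (le_inv_mul_iff₀ (norm_pos_iff.mpr hc)).mp h

theorem IsMatrixSeminorm.sub_le (hN : IsMatrixSeminorm A N) (n : ℕ)
    (v w : Matrix (Fin n) (Fin n) A.carrier) : N n (v - w) ≤ N n v + N n w := by
  have h := hN.add_le n v ((-1 : ℂ) • w)
  rw [hN.smul_eq, norm_neg, norm_one, one_mul, neg_one_smul, ← sub_eq_add_neg] at h
  exact h

theorem IsMatrixSeminorm.entry_eq_zero (hN : IsMatrixSeminorm A N) {n : ℕ}
    {v : Matrix (Fin n) (Fin n) A.carrier} (hv : N n v = 0) (i j : Fin n) :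
    N 1 (mat1 (v i j)) = 0 := by
  have h := hN.mmul_le n 1 (Matrix.of fun _ k => if k = i then 1 else 0) v
    (Matrix.of fun l _ => if l = j then 1 else 0)
  rw [hv, mul_zero, zero_mul] at h
  refine le_antisymm (le_trans (le_of_eq ?_) h) (hN.nonneg _ _)
  congr 1
  ext
  simp [mmulMat]

theorem IsMatrixSeminorm.eq_zero_of_entry (hN : IsMatrixSeminorm A N) {n : ℕ}
    {v : Matrix (Fin n) (Fin n) A.carrier} (hv : ∀ i j, N 1 (mat1 (v i j)) = 0) :
    N n v = 0 := by
  have hadd : ∀ v w, N n v = 0 → N n w = 0 → N n (v + w) = 0 := fun v w hv hw =>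
    le_antisymm ((hN.add_le n v w).trans (by rw [hv, hw, add_zero])) (hN.nonneg _ _)
  rw [Matrix.matrix_eq_sum_single v]
  refine Finset.sum_induction _ (fun w => N n w = 0) hadd (hN.zero n) fun k _ => ?_
  refine Finset.sum_induction _ (fun w => N n w = 0) hadd (hN.zero n) fun l _ => ?_
  have h := hN.mmul_le 1 n (Matrix.of fun i _ => if k = i then 1 else 0) (mat1 (v k l))
    (Matrix.of fun _ j => if l = j then 1 else 0)
  rw [hv, mul_zero, zero_mul] at h
  refine le_antisymm (le_trans (le_of_eq ?_) h) (hN.nonneg _ _)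
  congr 1
  ext i j
  by_cases h1 : k = i <;> by_cases h2 : l = j <;> simp [mmulMat, h1, h2]

end Seminorm

/-! ### The seminorm attached to a matrix bridge -/

section Bridge

variable {A B : MOUS} {LA : ∀ n : ℕ, Matrix (Fin n) (Fin n) A.carrier → ℝ}
  {LB : ∀ n : ℕ, Matrix (Fin n) (Fin n) B.carrier → ℝ}
  {N : ∀ n : ℕ, Matrix (Fin n) (Fin n) (A.prod B).carrier → ℝ}

/-- The matrix of first coordinates. -/
def fstMat {n : ℕ} (v : Matrix (Fin n) (Fin n) (A.prod B).carrier) :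
    Matrix (Fin n) (Fin n) A.carrier :=
  Matrix.of fun i j => (v i j).1

/-- The matrix of second coordinates. -/
def sndMat {n : ℕ} (v : Matrix (Fin n) (Fin n) (A.prod B).carrier) :
    Matrix (Fin n) (Fin n) B.carrier :=
  Matrix.of fun i j => (v i j).2

/-- The seminorm `max {L₁(a), L₂(b), N(a, b)}`. -/
def bridgeSeminorm (LA : ∀ n : ℕ, Matrix (Fin n) (Fin n) A.carrier → ℝ)
    (LB : ∀ n : ℕ, Matrix (Fin n) (Fin n) B.carrier → ℝ)
    (N : ∀ n : ℕ, Matrix (Fin n) (Fin n) (A.prod B).carrier → ℝ) (n : ℕ)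
    (v : Matrix (Fin n) (Fin n) (A.prod B).carrier) : ℝ :=
  max (LA n (fstMat v)) (max (LB n (sndMat v)) (N n v))

theorem fstMat_dsumMat {m n : ℕ} (v : Matrix (Fin m) (Fin m) (A.prod B).carrier)
    (w : Matrix (Fin n) (Fin n) (A.prod B).carrier) :
    fstMat (dsumMat v w) = dsumMat (fstMat v) (fstMat w) := by
  ext i j
  obtain ⟨i, rfl⟩ := finSumFinEquiv.surjective i
  obtain ⟨j, rfl⟩ := finSumFinEquiv.surjective j
  rcases i with i | i <;> rcases j with j | j <;>
    simp [fstMat, dsumMat, -finSumFinEquiv_apply_left, -finSumFinEquiv_apply_right] <;> rfl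

theorem sndMat_dsumMat {m n : ℕ} (v : Matrix (Fin m) (Fin m) (A.prod B).carrier)
    (w : Matrix (Fin n) (Fin n) (A.prod B).carrier) :
    sndMat (dsumMat v w) = dsumMat (sndMat v) (sndMat w) := by
  ext i j
  obtain ⟨i, rfl⟩ := finSumFinEquiv.surjective i
  obtain ⟨j, rfl⟩ := finSumFinEquiv.surjective j
  rcases i with i | i <;> rcases j with j | j <;>
    simp [sndMat, dsumMat, -finSumFinEquiv_apply_left, -finSumFinEquiv_apply_right] <;> rfl

theorem fstMat_mmulMat {m n : ℕ} (α : Matrix (Fin n) (Fin m) ℂ)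
    (v : Matrix (Fin m) (Fin m) (A.prod B).carrier) (β : Matrix (Fin m) (Fin n) ℂ) :
    fstMat (mmulMat α v β) = mmulMat α (fstMat v) β := by
  ext i j
  change fstL A B _ = _
  simp only [mmulMat, Matrix.of_apply, map_sum, map_smul]
  rfl

theorem sndMat_mmulMat {m n : ℕ} (α : Matrix (Fin n) (Fin m) ℂ)
    (v : Matrix (Fin m) (Fin m) (A.prod B).carrier) (β : Matrix (Fin m) (Fin n) ℂ) :
    sndMat (mmulMat α v β) = mmulMat α (sndMat v) β := by
  ext i j
  change sndL A B _ = _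
  simp only [mmulMat, Matrix.of_apply, map_sum, map_smul]
  rfl

namespace IsMatrixBridge

theorem unit_pos (hN : IsMatrixBridge A B LA LB N) :
    0 < N 1 (mat1 ((A.one, 0) : (A.prod B).carrier)) :=
  (hN.seminorm.nonneg _ _).lt_of_ne hN.unit_ne.symm

theorem one_ne_zero_left (hN : IsMatrixBridge A B LA LB N) : A.one ≠ 0 := by
  intro h
  apply hN.unit_ne
  rw [h]
  exact hN.seminorm.zero 1

theorem one_ne_zero_right (hN : IsMatrixBridge A B LA LB N) : B.one ≠ 0 := by
  intro h
  have := hN.unit_zero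
  rw [h] at this
  exact hN.unit_ne this

theorem smul_unit (hN : IsMatrixBridge A B LA LB N) (c : ℂ) :
    N 1 (mat1 (c • (A.prod B).one)) = 0 := by
  have := hN.seminorm.smul_eq 1 c (mat1 (A.prod B).one)
  rw [show N 1 (mat1 (A.prod B).one) = 0 from hN.unit_zero, mul_zero] at this
  exact this

theorem isMatrixLipschitzSeminorm (hN : IsMatrixBridge A B LA LB N)
    (hA : IsMatrixLipschitzSeminorm A LA) (hB : IsMatrixLipschitzSeminorm B LB) :
    IsMatrixLipschitzSeminorm (A.prod B) (bridgeSeminorm LA LB N) where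
  nonneg n v := le_max_of_le_left (hA.nonneg _ _)
  add_le n v w := by
    refine max_le ?_ (max_le ?_ ?_)
    · exact (hA.add_le n (fstMat v) (fstMat w)).trans
        (add_le_add (le_max_left _ _) (le_max_left _ _))
    · exact (hB.add_le n (sndMat v) (sndMat w)).trans (add_le_add
        (le_max_of_le_right (le_max_left _ _)) (le_max_of_le_right (le_max_left _ _)))
    · exact (hN.seminorm.add_le n v w).trans (add_le_add
        (le_max_of_le_right (le_max_right _ _)) (le_max_of_le_right (le_max_right _ _)))
  smul_eq n c v := by
    unfold bridgeSeminorm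
    rw [mul_max_of_nonneg _ _ (norm_nonneg c), mul_max_of_nonneg _ _ (norm_nonneg c),
      ← hA.smul_eq, ← hB.smul_eq, ← hN.seminorm.smul_eq]
    rfl
  null_iff n v := by
    constructor
    · intro h
      have h1 : LA n (fstMat v) = 0 :=
        le_antisymm ((le_max_left _ _).trans h.le) (hA.nonneg _ _)
      have h2 : LB n (sndMat v) = 0 :=
        le_antisymm ((le_max_of_le_right (le_max_left _ _)).trans h.le) (hB.nonneg _ _)
      have h3 : N n v = 0 := le_antisymm
        ((le_max_of_le_right (le_max_right _ _)).trans h.le) (hN.seminorm.nonneg _ _)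
      obtain ⟨lam, hlam⟩ := (hA.null_iff _ _).mp h1
      obtain ⟨mu, hmu⟩ := (hB.null_iff _ _).mp h2
      refine ⟨mu, ?_⟩
      refine Matrix.ext fun i j => ?_
      have e1 : (v i j).1 = lam i j • A.one := congrFun (congrFun hlam i) j
      have e2 : (v i j).2 = mu i j • B.one := congrFun (congrFun hmu i) j
      let u : (A.prod B).carrier := (A.one, 0)
      have e : (lam i j - mu i j) • mat1 u =
          mat1 (v i j) - mat1 (mu i j • (A.prod B).one) := by
        refine Matrix.ext fun _ _ => Prod.ext ?_ ?_
        · change (lam i j - mu i j) • A.one = (v i j).1 - mu i j • A.one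
          rw [e1, sub_smul]
        · change (lam i j - mu i j) • (0 : B.carrier) = (v i j).2 - mu i j • B.one
          rw [e2, smul_zero, sub_self]
      have h4 := hN.seminorm.sub_le 1 (mat1 (v i j)) (mat1 (mu i j • (A.prod B).one))
      rw [← e, hN.seminorm.smul_eq, hN.seminorm.entry_eq_zero h3, hN.smul_unit, add_zero] at h4
      have h5 : ‖lam i j - mu i j‖ ≤ 0 := nonpos_of_mul_nonpos_left h4 hN.unit_pos
      have h6 : lam i j = mu i j := sub_eq_zero.mp (norm_le_zero_iff.mp h5)
      exact Prod.ext (e1.trans (by rw [h6]; rfl)) e2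
    · rintro ⟨lam, rfl⟩
      have h1 := (hA.null_iff n _).mpr ⟨lam, rfl⟩
      have h2 := (hB.null_iff n _).mpr ⟨lam, rfl⟩
      have h3 : N n (Matrix.of fun i j => lam i j • (A.prod B).one) = 0 :=
        hN.seminorm.eq_zero_of_entry fun i j => hN.smul_unit _
      change max (LA n (Matrix.of fun i j => lam i j • A.one))
        (max (LB n (Matrix.of fun i j => lam i j • B.one)) _) = 0
      rw [h1, h2, h3, max_self, max_self]
  dsum_eq m n v w := by
    unfold bridgeSeminorm
    rw [fstMat_dsumMat, sndMat_dsumMat, hA.dsum_eq, hB.dsum_eq, hN.seminorm.dsum_eq,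
      max_max_max_comm (LB m _), max_max_max_comm (LA m _)]
  mmul_le m n α v β := by
    refine max_le ?_ (max_le ?_ ?_)
    · rw [fstMat_mmulMat]
      refine (hA.mmul_le m n α (fstMat v) β).trans (mul_le_mul_of_nonneg_right
        (mul_le_mul_of_nonneg_left (le_max_left _ _) ?_) ?_) <;> exact scalarOpNorm_nonneg _
    · rw [sndMat_mmulMat]
      refine (hB.mmul_le m n α (sndMat v) β).trans (mul_le_mul_of_nonneg_right
        (mul_le_mul_of_nonneg_left (le_max_of_le_right (le_max_left _ _)) ?_) ?_) <;>
        exact scalarOpNorm_nonneg _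
    · refine (hN.seminorm.mmul_le m n α v β).trans (mul_le_mul_of_nonneg_right
        (mul_le_mul_of_nonneg_left (le_max_of_le_right (le_max_right _ _)) ?_) ?_) <;>
        exact scalarOpNorm_nonneg _
  star_eq n v := by
    unfold bridgeSeminorm
    rw [hN.star_eq, ← hA.star_eq n (fstMat v), ← hB.star_eq n (sndMat v)]
    rfl

theorem hasLipNets (hN : IsMatrixBridge A B LA LB N) (hA : HasLipNets A LA)
    (hB : HasLipNets B LB) : HasLipNets (A.prod B) (bridgeSeminorm LA LB N) := by
  have hAB : (A.prod B).one ≠ 0 := fun h => hN.one_ne_zero_left (congrArg Prod.fst h)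
  intro ε hε
  obtain ⟨δ, hδ, hcont⟩ := hN.matrix_continuous 1 0 1 one_pos
  have hsmall : ∀ r : (A.prod B).carrier, (A.prod B).Bd (mat1 r) (δ / 2) →
      N 1 (mat1 r) < 1 := by
    intro r hr
    have := hcont (mat1 r) (by rw [sub_zero]; linarith [hr.matNorm_le hAB 0])
    rw [hN.seminorm.zero, sub_zero] at this
    exact (le_abs_self _).trans_lt this
  have hη : 0 < min (ε / 2) (δ / 2) := by positivity
  obtain ⟨F, hF, hFnet⟩ := hA _ hη
  obtain ⟨G, hG, hGnet⟩ := hB _ hη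
  obtain ⟨K, hK⟩ := ((hF.prod hG).image fun p : (A.prod B).carrier => N 1 (mat1 p)).bddAbove
  let e : (A.prod B).carrier := (A.one, 0)
  obtain ⟨t, ht, het⟩ := MOUS.exists_bd_mat1 e
  obtain ⟨P, -, hP, hcov⟩ := Metric.finite_approx_of_totallyBounded
    (isCompact_closedBall (0 : ℂ) ((K + 2) / N 1 (mat1 e))).totallyBounded
    (ε / (2 * (t + 1))) (by positivity)
  refine ⟨Set.image2 (fun p ρ => p + ρ • e) (F ×ˢ G) P, (hF.prod hG).image2 _ hP,
    fun v hv => ?_⟩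
  obtain ⟨f, hf, lam, hlam⟩ := hFnet v.1 ((le_max_left _ _).trans hv)
  obtain ⟨g, hg, mu, hmu⟩ := hGnet v.2 ((le_max_of_le_right (le_max_left _ _)).trans hv)
  let p : (A.prod B).carrier := (f, g)
  let r : (A.prod B).carrier := (v.1 - f - lam • A.one, v.2 - g - mu • B.one)
  have hr : (A.prod B).Bd (mat1 r) (min (ε / 2) (δ / 2)) := MOUS.bd_prod_iff.mpr ⟨hlam, hmu⟩
  have key : (lam - mu) • mat1 e =
      mat1 v - mat1 p - mat1 (mu • (A.prod B).one) - mat1 r := by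
    refine Matrix.ext fun _ _ => Prod.ext ?_ ?_
    · change (lam - mu) • A.one = v.1 - f - mu • A.one - (v.1 - f - lam • A.one)
      module
    · change (lam - mu) • (0 : B.carrier) = v.2 - g - mu • B.one - (v.2 - g - mu • B.one)
      simp
  have hN1 : N 1 (mat1 v) ≤ 1 := (le_max_of_le_right (le_max_right _ _)).trans hv
  have hp : N 1 (mat1 p) ≤ K := hK ⟨p, ⟨hf, hg⟩, rfl⟩
  have hbound : ‖lam - mu‖ ≤ (K + 2) / N 1 (mat1 e) := by
    rw [le_div_iff₀ hN.unit_pos, ← hN.seminorm.smul_eq, key]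
    have h1 := hN.seminorm.sub_le 1 (mat1 v) (mat1 p)
    have h2 := hN.seminorm.sub_le 1 (mat1 v - mat1 p) (mat1 (mu • (A.prod B).one))
    have h3 := hN.seminorm.sub_le 1 (mat1 v - mat1 p - mat1 (mu • (A.prod B).one)) (mat1 r)
    rw [hN.smul_unit] at h2
    linarith [hsmall r (hr.mono (min_le_right _ _))]
  obtain ⟨ρ, hρ, hd⟩ := Set.mem_iUnion₂.mp (hcov (mem_closedBall_zero_iff.mpr hbound))
  refine ⟨p + ρ • e, ⟨p, ⟨hf, hg⟩, ρ, hρ, rfl⟩, mu, ?_⟩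
  have hbd := hr.add (het.smul (lam - mu - ρ))
  have heq : mat1 r + (lam - mu - ρ) • mat1 e =
      mat1 (v - (p + ρ • e) - mu • (A.prod B).one) := by
    refine Matrix.ext fun _ _ => Prod.ext ?_ ?_
    · change v.1 - f - lam • A.one + (lam - mu - ρ) • A.one =
        v.1 - (f + ρ • A.one) - mu • A.one
      module
    · change v.2 - g - mu • B.one + (lam - mu - ρ) • (0 : B.carrier) =
        v.2 - (g + ρ • (0 : B.carrier)) - mu • B.one
      simp
  rw [heq] at hbd
  refine hbd.mono ?_
  rw [mem_ball_iff_norm, lt_div_iff₀ (by positivity)] at hd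
  have : ‖lam - mu - ρ‖ * t ≤ ε / 2 := by nlinarith [norm_nonneg (lam - mu - ρ)]
  linarith [min_le_left (ε / 2) (δ / 2)]

theorem induces_fst (hN : IsMatrixBridge A B LA LB N) (hA : IsMatrixLipschitzSeminorm A LA) :
    Induces (A.prod B) A (fstL A B) (bridgeSeminorm LA LB N) LA := by
  intro n a
  refine le_antisymm (le_csInf ⟨_, ⟨Matrix.of fun i j => (a i j, 0), rfl, rfl⟩⟩ ?_)
    (le_of_forall_pos_le_add fun ε hε => ?_)
  · rintro _ ⟨v, rfl, rfl⟩
    exact le_max_left _ _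
  · obtain ⟨b, hb⟩ := hN.approx₁ n a ε hε
    refine le_trans (csInf_le ⟨0, ?_⟩ ⟨Matrix.of fun i j => (a i j, b i j), rfl, rfl⟩)
      (max_le (le_add_of_nonneg_right hε.le) hb)
    rintro _ ⟨v, -, rfl⟩
    exact le_max_of_le_left (hA.nonneg _ _)

theorem induces_snd (hN : IsMatrixBridge A B LA LB N) (hA : IsMatrixLipschitzSeminorm A LA) :
    Induces (A.prod B) B (sndL A B) (bridgeSeminorm LA LB N) LB := by
  intro n b
  refine le_antisymm (le_csInf ⟨_, ⟨Matrix.of fun i j => (0, b i j), rfl, rfl⟩⟩ ?_)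
    (le_of_forall_pos_le_add fun ε hε => ?_)
  · rintro _ ⟨v, rfl, rfl⟩
    exact le_max_of_le_right (le_max_left _ _)
  · obtain ⟨a, ha⟩ := hN.approx₂ n b ε hε
    refine le_trans (csInf_le ⟨0, ?_⟩ ⟨Matrix.of fun i j => (a i j, b i j), rfl, rfl⟩)
      (max_le ((le_max_left _ _).trans ha)
        (max_le (le_add_of_nonneg_right hε.le) ((le_max_right _ _).trans ha)))
    rintro _ ⟨v, -, rfl⟩
    exact le_max_of_le_left (hA.nonneg _ _)

theorem isLSCsem (hN : IsMatrixBridge A B LA LB N) (hA : IsLSCsem A LA) (hB : IsLSCsem B LB) :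
    IsLSCsem (A.prod B) (bridgeSeminorm LA LB N) := by
  intro n v c hc
  rcases Nat.eq_zero_or_pos n with rfl | hn
  · exact ⟨1, one_pos, fun w _ => by rwa [Subsingleton.elim w v]⟩
  let i : Fin n := ⟨0, hn⟩
  rcases lt_max_iff.mp hc with h | h
  · obtain ⟨δ, hδ, hlsc⟩ := hA n _ c h
    exact ⟨δ, hδ, fun w hw => lt_max_of_lt_left
      (hlsc _ ((MOUS.matNorm_fst_le hN.one_ne_zero_left i (w - v)).trans_lt hw))⟩
  rcases lt_max_iff.mp h with h | h
  · obtain ⟨δ, hδ, hlsc⟩ := hB n _ c h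
    exact ⟨δ, hδ, fun w hw => lt_max_of_lt_right (lt_max_of_lt_left
      (hlsc _ ((MOUS.matNorm_snd_le hN.one_ne_zero_right i (w - v)).trans_lt hw)))⟩
  · obtain ⟨δ, hδ, hcont⟩ := hN.matrix_continuous n v _ (sub_pos.mpr h)
    refine ⟨δ, hδ, fun w hw => lt_max_of_lt_right (lt_max_of_lt_right ?_)⟩
    linarith [(abs_lt.mp (hcont w hw)).1]

end IsMatrixBridge

end Bridge

/-- Proposition 4.3 of the paper.  Let `N` be a matrix bridge between
quantized metric spaces `(V₁, L₁)` and `(V₂, L₂)`, and define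
`Lₙ(a, b) = max {L₁ₙ(a), L₂ₙ(b), Nₙ(a, b)}`.  Then `L` is a matrix Lip-norm on
`V₁ ⊕ V₂` which induces `L₁` and `L₂` via the coordinate projections; moreover if `L₁`
and `L₂` are lower semicontinuous then so is `L`. -/
theorem bridge_gives_matrix_lip_norm (A B : MOUS)
    (LA : ∀ n : ℕ, Matrix (Fin n) (Fin n) A.carrier → ℝ)
    (LB : ∀ n : ℕ, Matrix (Fin n) (Fin n) B.carrier → ℝ)
    (hA : IsMatrixLipNorm A LA) (hB : IsMatrixLipNorm B LB)
    (N : ∀ n : ℕ, Matrix (Fin n) (Fin n) (A.prod B).carrier → ℝ)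
    (hN : IsMatrixBridge A B LA LB N)
    (L : ∀ n : ℕ, Matrix (Fin n) (Fin n) (A.prod B).carrier → ℝ)
    (hLdef : ∀ n v, L n v =
      max (LA n (Matrix.of fun i j => (v i j).1))
        (max (LB n (Matrix.of fun i j => (v i j).2)) (N n v))) :
    IsMatrixLipNorm (A.prod B) L ∧
    Induces (A.prod B) A (fstL A B) L LA ∧
    Induces (A.prod B) B (sndL A B) L LB ∧
    (IsLSCsem A LA → IsLSCsem B LB → IsLSCsem (A.prod B) L) := by
  obtain rfl : L = bridgeSeminorm LA LB N := funext fun n => funext fun v => hLdef n v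
  exact ⟨(hN.hasLipNets (hA.hasLipNets hN.one_ne_zero_left)
      (hB.hasLipNets hN.one_ne_zero_right)).isMatrixLipNorm
        (hN.isMatrixLipschitzSeminorm hA.toIsMatrixLipschitzSeminorm
          hB.toIsMatrixLipschitzSeminorm),
    hN.induces_fst hA.toIsMatrixLipschitzSeminorm,
    hN.induces_snd hA.toIsMatrixLipschitzSeminorm, hN.isLSCsem⟩

end
end
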